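/- Let f : 𝕋 → ℝ be a continuous real-valued function on the circle 𝕋 = ℝ/2πℤ. Then there exist a homeomorphism h of 𝕋 onto itself and a continuous function v : 𝕋 → ℝ of bounded variation on 𝕋 such that the Fourier coefficients satisfy v̂(k) = -i·sgn(k)·(f∘h)^(k) for every k ∈ ℤ; that is, the function conjugate to the superposition f∘h is continuous and of bounded variation on 𝕋 (the Jurkat–Waterman theorem). -/

import Mathlib

open scoped Real

section JWproof
open scoped Real ENNReal Topology
open MeasureTheory Set Filter

noncomputable section
namespace JW


/-- the truncated cotangent kernel -/
def kap (x : ℝ) : ℝ := if 0 < x ∧ x < π then Real.cot (x / 2) else 0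

lemma kap_of {x : ℝ} (h0 : 0 < x) (h1 : x ≤ π) : kap x = Real.cot (x / 2) := by
  unfold kap
  rcases h1.lt_or_eq with h | h
  · simp [h0, h]
  · subst h; simp [Real.cot_eq_cos_div_sin]

lemma kap_zero {x : ℝ} (h : π ≤ x) : kap x = 0 := by
  unfold kap; rw [if_neg]; rintro ⟨_, h2⟩; linarith

lemma kap_zero' {x : ℝ} (h : x ≤ 0) : kap x = 0 := by
  unfold kap; rw [if_neg]; rintro ⟨h2, _⟩; linarith

lemma kap_pos {x : ℝ} (h0 : 0 < x) (h1 : x < π) : 0 < kap x := by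
  rw [kap_of h0 h1.le, Real.cot_eq_cos_div_sin]
  exact div_pos (Real.cos_pos_of_mem_Ioo ⟨by linarith, by linarith⟩)
    (Real.sin_pos_of_pos_of_lt_pi (by linarith) (by linarith))

lemma kap_nonneg (x : ℝ) : 0 ≤ kap x := by
  rcases le_or_gt x 0 with h | h
  · rw [kap_zero' h]
  rcases le_or_gt π x with h' | h'
  · rw [kap_zero h']
  exact (kap_pos h h').le

lemma kap_le {x : ℝ} (h0 : 0 < x) : kap x ≤ 2 / x := by
  rcases le_or_gt π x with h' | h'
  · rw [kap_zero h']; positivity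
  rw [kap_of h0 h'.le, Real.cot_eq_cos_div_sin]
  have hs := Real.sin_pos_of_pos_of_lt_pi (x := x / 2) (by linarith) (by linarith)
  have hc := Real.cos_pos_of_mem_Ioo (x := x / 2) ⟨by linarith, by linarith⟩
  have := Real.lt_tan (x := x / 2) (by linarith) (by linarith)
  rw [Real.tan_eq_sin_div_cos, lt_div_iff₀ hc] at this
  rw [div_le_div_iff₀ hs h0]; linarith

lemma kap_ge {x : ℝ} (h0 : 0 < x) (h1 : x ≤ 1) : x⁻¹ ≤ kap x := by
  have hpi := Real.pi_gt_three
  rw [kap_of h0 (by linarith), Real.cot_eq_cos_div_sin]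
  have hs := Real.sin_pos_of_pos_of_lt_pi (x := x / 2) (by linarith) (by linarith)
  have hs2 := Real.sin_lt (x := x / 2) (by linarith)
  have hc := Real.one_sub_sq_div_two_le_cos (x := x / 2)
  have : (1:ℝ)/2 ≤ Real.cos (x/2) := by nlinarith
  rw [inv_eq_one_div, div_le_div_iff₀ h0 hs]
  nlinarith

lemma measurable_kap : Measurable kap := by
  unfold kap
  refine Measurable.ite (measurableSet_Ioo (a := (0:ℝ)) (b := π)) ?_ measurable_const
  have : (fun x : ℝ => Real.cot (x/2)) = fun x => Real.cos (x/2) / Real.sin (x/2) := by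
    ext; rw [Real.cot_eq_cos_div_sin]
  rw [this]
  exact (Real.measurable_cos.comp (measurable_id.div_const 2)).div
    (Real.measurable_sin.comp (measurable_id.div_const 2))

lemma hasDerivAt_cot {x : ℝ} (h : Real.sin (x/2) ≠ 0) :
    HasDerivAt (fun x => Real.cot (x/2)) (-(1 / (2 * Real.sin (x/2) ^ 2))) x := by
  have : (fun x : ℝ => Real.cot (x/2)) = fun x => Real.cos (x/2) / Real.sin (x/2) := by
    ext; rw [Real.cot_eq_cos_div_sin]
  rw [this]
  have h1 : HasDerivAt (fun x : ℝ => x/2) (1/2) x := (hasDerivAt_id x).div_const 2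
  have := (h1.cos).div (h1.sin) h
  refine this.congr_deriv ?_
  have e := Real.sin_sq_add_cos_sq (x/2)
  rw [← neg_div, div_eq_div_iff (by positivity) (by positivity)]
  linear_combination (-Real.sin (x/2)^2) * e

lemma strictConvexOn_cot : StrictConvexOn ℝ (Ioc 0 π) (fun x => Real.cot (x/2)) := by
  have hsin : ∀ x ∈ Ioc 0 π, 0 < Real.sin (x/2) := fun x hx =>
    Real.sin_pos_of_pos_of_lt_pi (by linarith [hx.1]) (by linarith [hx.1, hx.2])
  apply StrictMonoOn.strictConvexOn_of_deriv (convex_Ioc _ _)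
  · intro x hx
    exact (hasDerivAt_cot (hsin x hx).ne').continuousAt.continuousWithinAt
  · rw [interior_Ioc]
    intro x hx y hy hxy
    have h1 := hsin x ⟨hx.1, hx.2.le⟩
    have h2 := hsin y ⟨hy.1, hy.2.le⟩
    rw [(hasDerivAt_cot h1.ne').deriv, (hasDerivAt_cot h2.ne').deriv]
    have : Real.sin (x/2) < Real.sin (y/2) :=
      Real.strictMonoOn_sin ⟨by linarith [hx.1, Real.pi_pos], by linarith [hx.2]⟩
        ⟨by linarith [hy.1, Real.pi_pos], by linarith [hy.2]⟩ (by linarith)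
    apply neg_lt_neg
    apply one_div_lt_one_div_of_lt (by positivity)
    nlinarith

lemma kap_strict {x z l m : ℝ} (hx : 0 < x) (hx' : x < π) (hxz : x < z) (hl : 0 < l) (hm : 0 < m)
    (hlm : l + m = 1) : kap (l * x + m * z) < l * kap x + m * kap z := by
  have hy1 : x < l * x + m * z := by nlinarith
  have hpx := kap_pos hx hx'
  have hz := kap_nonneg z
  rcases le_or_gt π (l * x + m * z) with h | h
  · rw [kap_zero h]; positivity
  rcases le_or_gt z π with h' | h'
  · rw [kap_of hx hx'.le, kap_of (hx.trans hxz) h', kap_of (hx.trans hy1) h.le]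
    exact strictConvexOn_cot.2 ⟨hx, hx'.le⟩ ⟨hx.trans hxz, h'⟩ hxz.ne hl hm hlm
  · set y := l * x + m * z with hy
    have hp : 0 < π - x := by linarith
    have := strictConvexOn_cot.2 ⟨hx, hx'.le⟩ ⟨Real.pi_pos, le_rfl⟩ hx'.ne
      (show 0 < (π - y)/(π - x) from div_pos (by linarith) hp)
      (show 0 < (y - x)/(π-x) from div_pos (by linarith) hp) (by field_simp; ring)
    have e : ((π - y)/(π - x)) • x + ((y - x)/(π-x)) • π = y := by
      simp only [smul_eq_mul]; field_simp; ring
    have c0 : Real.cot (π/2) = 0 := by simp [Real.cot_eq_cos_div_sin]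
    simp only [smul_eq_mul] at e this
    rw [e, c0, ← kap_of hx hx'.le, ← kap_of (hx.trans hy1) h.le] at this
    have h2 : (π - y)/(π - x) ≤ l := by
      rw [div_le_iff₀ hp]
      have hl' : l = 1 - m := by linarith
      subst hl'
      nlinarith
    rw [kap_zero h'.le]
    nlinarith

lemma kap_convex {x z l m : ℝ} (hx : 0 < x) (hxz : x < z) (hl : 0 < l) (hm : 0 < m)
    (hlm : l + m = 1) : kap (l * x + m * z) ≤ l * kap x + m * kap z := by
  rcases lt_or_ge x π with h | h
  · exact (kap_strict hx h hxz hl hm hlm).le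
  · rw [kap_zero h, kap_zero (h.trans hxz.le), kap_zero (by nlinarith)]; simp

lemma lint_kap : ∫⁻ x, ENNReal.ofReal (kap x) = ⊤ := by
  have h : ¬ IntegrableOn (fun x : ℝ => x⁻¹) (Ioc 0 1) := by
    rw [← intervalIntegrable_iff_integrableOn_Ioc_of_le zero_le_one, intervalIntegrable_inv_iff]
    simp
  by_contra hne
  apply h
  refine Integrable.mono' (g := kap) ?_ (by fun_prop) ?_
  · refine Integrable.integrableOn ⟨measurable_kap.aestronglyMeasurable, ?_⟩
    rw [hasFiniteIntegral_iff_ofReal (Eventually.of_forall kap_nonneg)]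
    exact lt_top_iff_ne_top.2 hne
  · refine (ae_restrict_iff' measurableSet_Ioc).2 (Eventually.of_forall fun x hx => ?_)
    rw [Real.norm_of_nonneg (inv_nonneg.2 hx.1.le)]
    exact kap_ge hx.1 hx.2

/-- cot(x/2)+x/2 is antitone on (0,2π) -/
lemma cot_anti : AntitoneOn (fun x => Real.cot (x/2) + x/2) (Ioo 0 (2*π)) := by
  have hsin : ∀ x ∈ Ioo 0 (2*π), 0 < Real.sin (x/2) := fun x hx =>
    Real.sin_pos_of_pos_of_lt_pi (by linarith [hx.1]) (by linarith [hx.1, hx.2])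
  have hd : ∀ x ∈ Ioo 0 (2*π), HasDerivAt (fun x => Real.cot (x/2) + x/2)
    (-(1 / (2 * Real.sin (x/2) ^ 2)) + 1/2) x := fun x hx =>
      (hasDerivAt_cot (hsin x hx).ne').add ((hasDerivAt_id x).div_const 2)
  refine antitoneOn_of_deriv_nonpos (convex_Ioo _ _)
    (fun x hx => (hd x hx).continuousAt.continuousWithinAt) ?_ ?_
  · rw [interior_Ioo]; exact fun x hx => (hd x hx).differentiableAt.differentiableWithinAt
  · rw [interior_Ioo]; intro x hx
    rw [(hd x hx).deriv]
    have := hsin x hx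
    have h2 : Real.sin (x/2)^2 ≤ 1 := Real.sin_sq_le_one _
    have : 1/2 ≤ 1 / (2 * Real.sin (x/2)^2) := one_div_le_one_div_of_le (by positivity) (by linarith)
    linarith



structure Adm (θ : ℝ → ℝ) : Prop where
  mono : Monotone θ
  per : ∀ x, θ (x + 2 * π) = θ x + 2 * π

def V (θ : ℝ → ℝ) (s : ℝ) : ℝ≥0∞ :=
  ∫⁻ τ, ENNReal.ofReal (kap τ) * ENNReal.ofReal (θ (s + τ) - θ (s - τ))

lemma Adm.id : Adm (fun x => x) := ⟨monotone_id, fun _ => rfl⟩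

lemma Adm.per_sub {θ : ℝ → ℝ} (h : Adm θ) (x : ℝ) : θ (x - 2 * π) = θ x - 2 * π := by
  have := h.per (x - 2 * π); rw [sub_add_cancel] at this; linarith

lemma V_per {θ : ℝ → ℝ} (h : Adm θ) : Function.Periodic (V θ) (2 * π) := by
  intro s
  unfold V
  congr 1; ext τ
  rw [show s + 2 * π + τ = s + τ + 2 * π by ring, show s + 2 * π - τ = s - τ + 2 * π by ring,
    h.per, h.per, add_sub_add_right_eq_sub]

lemma meas2 {θ : ℝ → ℝ} (h : Adm θ) : Measurable (fun p : ℝ × ℝ =>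
    ENNReal.ofReal (kap p.2) * ENNReal.ofReal (θ (p.1 + p.2) - θ (p.1 - p.2))) := by
  have h1 := h.mono.measurable
  have h2 := measurable_kap
  fun_prop

lemma measurable_V {θ : ℝ → ℝ} (h : Adm θ) : Measurable (V θ) :=
  Measurable.lintegral_prod_right (meas2 h)

lemma adm_sub_per {θ : ℝ → ℝ} (h : Adm θ) : Function.Periodic (fun x => θ x - x) (2 * π) := by
  intro x; simp only [h.per]; ring

lemma adm_ii {θ : ℝ → ℝ} (h : Adm θ) (a b : ℝ) : IntervalIntegrable θ volume a b :=
  h.mono.intervalIntegrable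

lemma shift_int {θ : ℝ → ℝ} (h : Adm θ) (c : ℝ) :
    ∫ s in (0:ℝ)..(2*π), (θ (s + c) - (s + c)) = ∫ s in (0:ℝ)..(2*π), (θ s - s) := by
  rw [intervalIntegral.integral_comp_add_right (fun x => θ x - x) c]
  have := (adm_sub_per h).intervalIntegral_add_eq c 0
  rw [zero_add, add_comm c] at *
  simpa using this

lemma diff_int {θ : ℝ → ℝ} (h : Adm θ) (τ : ℝ) :
    ∫ s in (0:ℝ)..(2*π), (θ (s + τ) - θ (s - τ)) = 4 * π * τ := by
  have i1 : IntervalIntegrable (fun s => θ (s + τ) - (s + τ)) volume 0 (2*π) := by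
    have : Monotone (fun s => θ (s+τ)) := fun x y hxy => h.mono (by linarith)
    exact this.intervalIntegrable.sub (by apply Continuous.intervalIntegrable; fun_prop)
  have i2 : IntervalIntegrable (fun s => θ (s + -τ) - (s + -τ)) volume 0 (2*π) := by
    have : Monotone (fun s => θ (s+ -τ)) := fun x y hxy => h.mono (by linarith)
    exact this.intervalIntegrable.sub (by apply Continuous.intervalIntegrable; fun_prop)
  have e : ∀ s, θ (s + τ) - θ (s - τ) =
      ((θ (s + τ) - (s + τ)) - (θ (s + -τ) - (s + -τ))) + 2 * τ := by
    intro s; rw [← sub_eq_add_neg]; ring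
  simp_rw [e]
  rw [intervalIntegral.integral_add (i1.sub i2) (by simp), intervalIntegral.integral_sub i1 i2,
    shift_int h, shift_int h]
  simp; ring

lemma diff_lint {θ : ℝ → ℝ} (h : Adm θ) {τ : ℝ} (hτ : 0 ≤ τ) :
    ∫⁻ s in Ioc 0 (2*π), ENNReal.ofReal (θ (s + τ) - θ (s - τ)) = ENNReal.ofReal (4 * π * τ) := by
  have hpi := Real.pi_pos
  rw [← diff_int h τ, intervalIntegral.integral_of_le (by positivity),
    ofReal_integral_eq_lintegral_ofReal]
  · rw [← IntegrableOn, ← intervalIntegrable_iff_integrableOn_Ioc_of_le (by positivity)]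
    have h1 : Monotone (fun s => θ (s+τ)) := fun x y hxy => h.mono (by linarith)
    have h2 : Monotone (fun s => θ (s-τ)) := fun x y hxy => h.mono (by linarith)
    exact h1.intervalIntegrable.sub h2.intervalIntegrable
  · exact Eventually.of_forall fun s => sub_nonneg.2 (h.mono (by linarith))

lemma int_small {θ : ℝ → ℝ} (h : Adm θ) {δ : ℝ} :
    ∫⁻ s in Ioc 0 (2*π), ∫⁻ τ in Ioc 0 δ,
      ENNReal.ofReal (kap τ) * ENNReal.ofReal (θ (s + τ) - θ (s - τ)) ≤
      ENNReal.ofReal (8 * π * δ) := by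
  rw [lintegral_lintegral_swap (meas2 h).aemeasurable]
  calc _ ≤ ∫⁻ τ in Ioc 0 δ, ENNReal.ofReal (8 * π) := by
        refine setLIntegral_mono measurable_const fun τ hτ => ?_
        rw [lintegral_const_mul _ (by
          have h1 := h.mono.measurable
          fun_prop), diff_lint h hτ.1.le, ← ENNReal.ofReal_mul (kap_nonneg _)]
        apply ENNReal.ofReal_le_ofReal
        have := kap_le hτ.1
        have h0 := hτ.1
        rw [le_div_iff₀ h0] at this
        nlinarith [Real.pi_pos]
    _ = _ := by
      rw [setLIntegral_const, Real.volume_Ioc, sub_zero, ← ENNReal.ofReal_mul (by positivity)]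

lemma V_eq {θ : ℝ → ℝ} (s : ℝ) : V θ s = ∫⁻ τ in Ioc 0 π,
      ENNReal.ofReal (kap τ) * ENNReal.ofReal (θ (s + τ) - θ (s - τ)) := by
  unfold V
  rw [← lintegral_indicator measurableSet_Ioc]
  congr 1; ext τ
  by_cases hτ : τ ∈ Ioc 0 π
  · rw [indicator_of_mem hτ]
  · rw [indicator_of_notMem hτ]
    have : kap τ = 0 := by
      rcases le_or_gt τ 0 with h | h
      · exact kap_zero' h
      · exact kap_zero (le_of_not_ge fun h2 => hτ ⟨h, h2⟩)
    simp [this]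

lemma V_lint {θ : ℝ → ℝ} (h : Adm θ) :
    ∫⁻ s in Ioc 0 (2*π), V θ s ≤ ENNReal.ofReal (8 * π * π) := by
  simp_rw [V_eq]; exact int_small h

lemma ae_cont {θ : ℝ → ℝ} (h : Adm θ) : ∀ᵐ x, ContinuousAt θ x := by
  have := h.mono.countable_not_continuousAt.measure_zero volume
  rw [ae_iff]; exact this

lemma ae_cont2 {θ : ℝ → ℝ} (h : Adm θ) (s : ℝ) :
    ∀ᵐ τ, ContinuousAt θ (s + τ) ∧ ContinuousAt θ (s - τ) := by
  have h1 := (measurePreserving_add_left volume s).quasiMeasurePreserving.ae (ae_cont h)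
  have h2 := (Measure.measurePreserving_sub_left volume s).quasiMeasurePreserving.ae (ae_cont h)
  exact h1.and h2

/-- lower semicontinuity -/
lemma V_lsc {θ : ℝ → ℝ} (h : Adm θ) : LowerSemicontinuous (V θ) := by
  intro s y hy
  by_contra hcon
  have hcon : ∃ᶠ x in 𝓝 s, V θ x ≤ y := by
    rw [Filter.not_eventually] at hcon
    exact hcon.mono fun x hx => not_lt.1 hx
  obtain ⟨u, hu, hu2⟩ := exists_seq_forall_of_frequently hcon
  have hF : V θ s ≤ liminf (fun n => V θ (u n)) atTop := by
    calc V θ s ≤ ∫⁻ τ, liminf (fun n => ENNReal.ofReal (kap τ) *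
          ENNReal.ofReal (θ (u n + τ) - θ (u n - τ))) atTop := by
          refine lintegral_mono_ae ?_
          filter_upwards [ae_cont2 h s] with τ hτ
          have t1 : Tendsto (fun n => θ (u n + τ)) atTop (𝓝 (θ (s + τ))) :=
            hτ.1.tendsto.comp (hu.add_const τ)
          have t2 : Tendsto (fun n => θ (u n - τ)) atTop (𝓝 (θ (s - τ))) :=
            hτ.2.tendsto.comp (hu.sub_const τ)
          have t3 := ENNReal.Tendsto.const_mul (a := ENNReal.ofReal (kap τ))
            (ENNReal.tendsto_ofReal (t1.sub t2)) (Or.inr ENNReal.ofReal_ne_top)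
          rw [t3.liminf_eq]
      _ ≤ _ := lintegral_liminf_le fun n => by
          have h1 := h.mono.measurable
          have h2 := measurable_kap
          fun_prop
  have : liminf (fun n => V θ (u n)) atTop ≤ y := by
    calc _ ≤ liminf (fun n : ℕ => y) atTop := liminf_le_liminf (Eventually.of_forall hu2)
      _ = y := by simp
  exact absurd (hF.trans this) (not_le.2 hy)

lemma V_jump {θ : ℝ → ℝ} (h : Adm θ) {s : ℝ} (hs : ¬ ContinuousAt θ s) : V θ s = ⊤ := by
  rw [h.mono.continuousAt_iff_leftLim_eq_rightLim] at hs
  have hlt : Function.leftLim θ s < Function.rightLim θ s :=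
    lt_of_le_of_ne (h.mono.leftLim_le_rightLim le_rfl) hs
  set d := Function.rightLim θ s - Function.leftLim θ s
  have hd : 0 < d := sub_pos.2 hlt
  rw [eq_top_iff]
  calc ⊤ = (∫⁻ τ, ENNReal.ofReal (kap τ)) * ENNReal.ofReal d := by
        rw [lint_kap, ENNReal.top_mul]; simpa using hd
    _ = ∫⁻ τ, ENNReal.ofReal (kap τ) * ENNReal.ofReal d := by
        rw [lintegral_mul_const]; exact measurable_kap.ennreal_ofReal
    _ ≤ _ := by
        refine lintegral_mono fun τ => ?_
        rcases le_or_gt τ 0 with h0 | h0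
        · simp [kap_zero' h0]
        · dsimp only
          gcongr
          have h1 := h.mono.rightLim_le (x := s) (y := s + τ) (by linarith)
          have h2 := h.mono.le_leftLim (x := s - τ) (y := s) (by linarith)
          simp only [d]; linarith

lemma V_pos {θ : ℝ → ℝ} (h : Adm θ) (hs : StrictMono θ) (s : ℝ) : 0 < V θ s := by
  have hpi := Real.pi_pos
  have h1 := h.mono.measurable
  have h2 := measurable_kap
  unfold V
  rw [lintegral_pos_iff_support (by fun_prop)]
  refine lt_of_lt_of_le (b := volume (Ioo 0 π)) (by simp [hpi]) (measure_mono fun τ hτ => ?_)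
  have := kap_pos hτ.1 hτ.2
  have := hs (show s - τ < s + τ by linarith [hτ.1])
  simp only [Function.mem_support, ne_eq, mul_eq_zero, ENNReal.ofReal_eq_zero, not_or]
  constructor <;> linarith

/-- strict convexity on plateaus -/
lemma V_plateau {θ : ℝ → ℝ} (h : Adm θ) {a b α : ℝ} (hab : a < b)
    (hpl : ∀ t ∈ Icc a b, θ t = α) (hmax : ∀ t, b < t → α < θ t) {M : ℝ≥0∞} (hM : M ≠ ⊤)
    (ha : V θ a ≤ M) (hb : V θ b ≤ M) {s : ℝ} (hs : s ∈ Ioo a b) : V θ s < M := by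
  have hm1 := h.mono.measurable
  have hm2 := measurable_kap
  have hpi := Real.pi_pos
  set W : ℝ → ℝ → ℝ≥0∞ := fun s t => ENNReal.ofReal (kap (t - s)) * ENNReal.ofReal (θ t - α) +
    ENNReal.ofReal (kap (s - t)) * ENNReal.ofReal (α - θ t) with hW
  have hWm : ∀ s, Measurable (W s) := fun s => by simp only [hW]; fun_prop
  have key : ∀ s ∈ Icc a b, V θ s = ∫⁻ t, W s t := by
    intro s hs
    simp only [hW]
    rw [lintegral_add_left (by fun_prop)]
    rw [← lintegral_add_left_eq_self (fun t => ENNReal.ofReal (kap (t - s)) * ENNReal.ofReal (θ t - α)) s,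
      ← lintegral_sub_left_eq_self (fun t => ENNReal.ofReal (kap (s - t)) * ENNReal.ofReal (α - θ t)) s,
      ← lintegral_add_left (by fun_prop)]
    unfold V
    congr 1; ext τ
    rcases le_or_gt τ 0 with h0 | h0
    · simp [kap_zero' h0]
    · have h1 := h.mono (show s ≤ s + τ by linarith)
      have h2 := h.mono (show s - τ ≤ s by linarith)
      rw [hpl s hs] at h1 h2
      rw [add_sub_cancel_left, sub_sub_cancel, ← mul_add, ← ENNReal.ofReal_add (by linarith) (by linarith)]
      congr 2; ring
  obtain ⟨l, m, hl, hm, hlm, hse⟩ : ∃ l m : ℝ, 0 < l ∧ 0 < m ∧ l + m = 1 ∧ s = l * a + m * b := by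
    refine ⟨(b - s)/(b-a), (s-a)/(b-a), div_pos (by linarith [hs.2]) (by linarith),
      div_pos (by linarith [hs.1]) (by linarith), ?_, ?_⟩
    · have : b - a ≠ 0 := by linarith
      field_simp; ring
    · have : b - a ≠ 0 := by linarith
      field_simp; ring
  rw [key s ⟨hs.1.le, hs.2.le⟩]
  rw [key a ⟨le_rfl, hab.le⟩] at ha
  rw [key b ⟨hab.le, le_rfl⟩] at hb
  have hle : ∀ t, W s t ≤ ENNReal.ofReal l * W a t + ENNReal.ofReal m * W b t := by
    intro t
    simp only [hW]
    rcases lt_or_ge t a with h0 | h0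
    · have e1 : α - θ t ≥ 0 := by have := h.mono h0.le; rw [hpl a ⟨le_rfl, hab.le⟩] at this; linarith
      have e2 : ENNReal.ofReal (θ t - α) = 0 := ENNReal.ofReal_eq_zero.2 (by linarith)
      rw [e2]
      simp only [mul_zero, zero_add, ← mul_assoc]
      rw [← add_mul, ← ENNReal.ofReal_mul hl.le, ← ENNReal.ofReal_mul hm.le, ← ENNReal.ofReal_add
        (mul_nonneg hl.le (kap_nonneg _)) (mul_nonneg hm.le (kap_nonneg _))]
      gcongr
      have := kap_convex (x := a - t) (z := b - t) (by linarith) (by linarith) hl hm hlm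
      convert this using 2
      rw [hse]; linear_combination (t) * hlm
    rcases le_or_gt t b with h1 | h1
    · simp [hpl t ⟨h0, h1⟩]
    · have e1 := hmax t h1
      have e2 : ENNReal.ofReal (α - θ t) = 0 := ENNReal.ofReal_eq_zero.2 (by linarith)
      rw [e2]
      simp only [mul_zero, add_zero, ← mul_assoc]
      rw [← add_mul, ← ENNReal.ofReal_mul hl.le, ← ENNReal.ofReal_mul hm.le, ← ENNReal.ofReal_add
        (mul_nonneg hl.le (kap_nonneg _)) (mul_nonneg hm.le (kap_nonneg _))]
      gcongr
      have := kap_convex (x := t - b) (z := t - a) (by linarith) (by linarith) hm hl (by linarith)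
      rw [add_comm (l * _)]
      convert this using 2
      rw [hse]; linear_combination (-t) * hlm
  have hlt : ∀ t ∈ Ioo b (b + π), W s t < ENNReal.ofReal l * W a t + ENNReal.ofReal m * W b t := by
    intro t ht
    simp only [hW]
    have e1 := hmax t ht.1
    have e2 : ENNReal.ofReal (α - θ t) = 0 := ENNReal.ofReal_eq_zero.2 (by linarith)
    rw [e2]
    simp only [mul_zero, add_zero, ← mul_assoc]
    rw [← add_mul, ← ENNReal.ofReal_mul hl.le, ← ENNReal.ofReal_mul hm.le, ← ENNReal.ofReal_add
        (mul_nonneg hl.le (kap_nonneg _)) (mul_nonneg hm.le (kap_nonneg _))]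
    have := kap_strict (x := t - b) (z := t - a) (by linarith [ht.1]) (by linarith [ht.2])
      (by linarith) hm hl (by linarith)
    rw [add_comm (l * _)]
    have e3 : m * (t - b) + l * (t - a) = t - s := by
      rw [hse]; linear_combination (t) * hlm
    rw [e3] at this
    have hx : 0 < m * kap (t - b) + l * kap (t - a) := lt_of_le_of_lt (kap_nonneg _) this
    refine ENNReal.mul_lt_mul_left ?_ ENNReal.ofReal_ne_top ?_
    · simpa using e1
    · exact (ENNReal.ofReal_lt_ofReal_iff hx).2 this
  have hR : ∫⁻ t, (ENNReal.ofReal l * W a t + ENNReal.ofReal m * W b t) ≤ M := by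
    rw [lintegral_add_left ((hWm a).const_mul _), lintegral_const_mul _ (hWm a), lintegral_const_mul _ (hWm b)]
    calc _ ≤ ENNReal.ofReal l * M + ENNReal.ofReal m * M := by gcongr
      _ = M := by rw [← add_mul, ← ENNReal.ofReal_add hl.le hm.le, hlm]; simp
  refine lt_of_lt_of_le ?_ hR
  refine lintegral_strict_mono_of_ae_le_of_ae_lt_on (s := Ioo b (b+π)) ?_ ?_ ?_ ?_ ?_
  · exact (((hWm a).const_mul _).add ((hWm b).const_mul _)).aemeasurable
  · exact ((lintegral_mono hle).trans_lt (hR.trans_lt (lt_top_iff_ne_top.2 hM))).ne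
  · exact Eventually.of_forall hle
  · simp [hpi]
  · exact Eventually.of_forall hlt



lemma Adm.per_int {θ : ℝ → ℝ} (h : Adm θ) (x : ℝ) (m : ℤ) :
    θ (x + m * (2 * π)) = θ x + m * (2 * π) := by
  have := (adm_sub_per h).int_mul m x
  linarith

lemma exists_rep (a x : ℝ) : ∃ (m : ℤ) (y : ℝ), y ∈ Ioc a (a + 2 * π) ∧ x = y + m * (2 * π) := by
  have h := Real.two_pi_pos
  refine ⟨toIocDiv h a x, toIocMod h a x, toIocMod_mem_Ioc h a x, ?_⟩
  have := toIocMod_add_toIocDiv_zsmul h a x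
  rw [zsmul_eq_mul] at this; exact this.symm

lemma ae_of_periodic {p : ℝ → Prop} (hp : ∀ s, p (s + 2 * π) ↔ p s) (a : ℝ)
    (h : ∀ᵐ s, s ∈ Ioc a (a + 2 * π) → p s) : ∀ᵐ s, p s := by
  have hp' : ∀ s (m : ℤ), p (s + m * (2 * π)) ↔ p s := fun s m => by
    have : Function.Periodic p (2 * π) := fun s => propext (hp s)
    rw [this.int_mul m s]
  have h2 : ∀ m : ℤ, ∀ᵐ s, s + -m * (2*π) ∈ Ioc a (a + 2 * π) → p (s + -m * (2*π)) := fun m =>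
    (measurePreserving_add_right volume (-m * (2*π))).quasiMeasurePreserving.ae h
  filter_upwards [ae_all_iff.2 h2] with s hs
  obtain ⟨m, y, hy, rfl⟩ := exists_rep a s
  have := hs m
  rw [show y + m * (2*π) + -m * (2*π) = y by ring] at this
  exact (hp' y m).2 (this hy)

lemma adm_bound {θ : ℝ → ℝ} (h : Adm θ) (h0 : θ 0 ∈ Icc 0 (2*π)) (x : ℝ) :
    θ x ∈ Icc (x - 2 * π) (x + 4 * π) := by
  obtain ⟨m, y, hy, rfl⟩ := exists_rep 0 x
  rw [h.per_int]
  have h1 := h.mono hy.1.le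
  have h2 := h.mono hy.2
  rw [h.per] at h2
  constructor <;> linarith [hy.1, hy.2, h0.1, h0.2]

lemma helly {θ : ℕ → ℝ → ℝ} (h : ∀ n, Adm (θ n)) (h0 : ∀ n, θ n 0 ∈ Icc 0 (2*π)) :
    ∃ (φ : ℕ → ℕ) (ψ : ℝ → ℝ), StrictMono φ ∧ Adm ψ ∧
      ∀ x, ContinuousAt ψ x → Tendsto (fun n => θ (φ n) x) atTop (𝓝 (ψ x)) := by
  have hpi := Real.two_pi_pos
  have hc : IsCompact (Set.pi univ (fun q : ℚ => Icc (2 * π * q - 2 * π) (2 * π * q + 4 * π))) :=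
    isCompact_univ_pi fun q => isCompact_Icc
  obtain ⟨g, -, φ, hφ, hg⟩ := hc.tendsto_subseq (x := fun n (q : ℚ) => θ n (2 * π * q))
    (fun n q _ => adm_bound (h n) (h0 n) _)
  rw [tendsto_pi_nhds] at hg
  have hgm : Monotone g := fun p q hpq => le_of_tendsto_of_tendsto' (hg p) (hg q) fun n =>
    (h _).mono (by have : (p:ℝ) ≤ q := by exact_mod_cast hpq
                   gcongr)
  have hg1 : ∀ q, g (q + 1) = g q + 2 * π := fun q => by
    refine tendsto_nhds_unique (hg (q+1)) ?_
    refine ((hg q).add_const (2*π)).congr fun n => ?_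
    simp only [Function.comp]
    rw [← (h _).per]; congr 1; push_cast; ring
  have hne : ∀ x : ℝ, ∃ q : ℚ, 2 * π * q < x := fun x => by
    obtain ⟨q, hq⟩ := exists_rat_lt (x / (2*π))
    exact ⟨q, by rw [lt_div_iff₀ hpi] at hq; linarith⟩
  have hbt : ∀ x y : ℝ, x < y → ∃ q : ℚ, x < 2 * π * q ∧ 2 * π * q < y := fun x y hxy => by
    obtain ⟨q, hq, hq'⟩ := exists_rat_btwn (div_lt_div_of_pos_right hxy hpi)
    rw [div_lt_iff₀ hpi] at hq; rw [lt_div_iff₀ hpi] at hq'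
    exact ⟨q, by linarith, by linarith⟩
  set S : ℝ → Set ℝ := fun x => g '' {q : ℚ | 2 * π * q < x} with hS
  have hSne : ∀ x, (S x).Nonempty := fun x => by
    obtain ⟨q, hq⟩ := hne x; exact ⟨_, q, hq, rfl⟩
  have hub : ∀ (x : ℝ) (q : ℚ), x ≤ 2 * π * q → g q ∈ upperBounds (S x) := by
    rintro x q hx _ ⟨p, hp, rfl⟩
    have : 2 * π * (p:ℝ) < 2 * π * q := lt_of_lt_of_le hp hx
    have : (p:ℝ) < q := lt_of_mul_lt_mul_left this hpi.le
    exact hgm (by exact_mod_cast this.le)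
  have hSb : ∀ x, BddAbove (S x) := fun x => by
    obtain ⟨q, hq, -⟩ := hbt x (x+1) (by linarith); exact ⟨_, hub x q hq.le⟩
  have L1 : ∀ (x : ℝ) (q : ℚ), x ≤ 2 * π * q → sSup (S x) ≤ g q := fun x q hx =>
    csSup_le (hSne x) (hub x q hx)
  have L2 : ∀ (x : ℝ) (q : ℚ), 2 * π * q < x → g q ≤ sSup (S x) := fun x q hx =>
    le_csSup (hSb x) ⟨q, hx, rfl⟩
  refine ⟨φ, fun x => sSup (S x), hφ, ⟨?_, ?_⟩, ?_⟩
  · intro x y hxy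
    refine csSup_le_csSup (hSb y) (hSne x) (image_mono fun q hq => ?_)
    exact lt_of_lt_of_le (show 2 * π * (q:ℝ) < x from hq) hxy
  · intro x
    apply le_antisymm
    · refine csSup_le (hSne _) ?_
      rintro _ ⟨q, hq, rfl⟩
      have := hg1 (q - 1)
      rw [sub_add_cancel] at this
      rw [this]
      have hq : 2 * π * (q:ℝ) < x + 2 * π := hq
      have := L2 x (q-1) (by push_cast; linarith)
      linarith
    · have : sSup (S x) ≤ sSup (S (x + 2 * π)) - 2 * π := by
        refine csSup_le (hSne _) ?_
        rintro _ ⟨q, hq, rfl⟩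
        have hq : 2 * π * (q:ℝ) < x := hq
        have := L2 (x + 2 * π) (q+1) (by push_cast; linarith)
        rw [hg1] at this; linarith
      linarith
  · intro x hx
    refine tendsto_order.2 ⟨fun y hy => ?_, fun y hy => ?_⟩
    · have e := (tendsto_order.1 hx.tendsto).1 y hy
      obtain ⟨z, hz, hz2⟩ := ((e.filter_mono (nhdsWithin_le_nhds (s := Iio x))).and self_mem_nhdsWithin).exists
      obtain ⟨q, hq, hq2⟩ := hbt z x hz2
      have : y < g q := lt_of_lt_of_le hz (L1 z q hq.le)
      filter_upwards [(tendsto_order.1 (hg q)).1 y this] with n hn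
      exact lt_of_lt_of_le hn ((h _).mono hq2.le)
    · have e := (tendsto_order.1 hx.tendsto).2 y hy
      obtain ⟨z, hz, hz2⟩ := ((e.filter_mono (nhdsWithin_le_nhds (s := Ioi x))).and self_mem_nhdsWithin).exists
      obtain ⟨q, hq, hq2⟩ := hbt x z hz2
      have : g q < y := lt_of_le_of_lt (L2 z q hq2) hz
      filter_upwards [(tendsto_order.1 (hg q)).2 y this] with n hn
      exact lt_of_le_of_lt ((h _).mono hq.le) hn

def Feas (F : ℝ → ℝ) (θ : ℝ → ℝ) (c : ℝ) : Prop :=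
  Adm θ ∧ ∀ᵐ s, ENNReal.ofReal (F (θ s) + c) ≤ V θ s

lemma feas_limit {F : ℝ → ℝ} (hF : Continuous F) (hFp : Function.Periodic F (2*π))
    {θ : ℕ → ℝ → ℝ} {c : ℕ → ℝ} {ψ : ℝ → ℝ} {d : ℝ}
    (h : ∀ n, Feas F (θ n) (c n)) (hψ : Adm ψ) (hc : Tendsto c atTop (𝓝 d))
    (ht : ∀ x, ContinuousAt ψ x → Tendsto (fun n => θ n x) atTop (𝓝 (ψ x))) : Feas F ψ d := by
  refine ⟨hψ, ?_⟩
  have hpi := Real.pi_pos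
  have hk := measurable_kap
  have hmψ := hψ.mono.measurable
  have hmθ := fun n => (h n).1.mono.measurable
  set I : (ℝ → ℝ) → ℝ → ℝ → ℝ≥0∞ := fun θ s τ =>
    ENNReal.ofReal (kap τ) * ENNReal.ofReal (θ (s + τ) - θ (s - τ)) with hI
  have main : ∀ δ, 0 < δ → δ < π →
      ∫⁻ s in Ioc 0 (2*π), (ENNReal.ofReal (F (ψ s) + d) - V ψ s) ≤ ENNReal.ofReal (8 * π * δ) := by
    intro δ hδ hδ'
    have split : ∀ θ s, V θ s = (∫⁻ τ in Ioc 0 δ, I θ s τ) + ∫⁻ τ in Ioc δ π, I θ s τ := by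
      intro θ s
      rw [V_eq, ← lintegral_union measurableSet_Ioc (by
        rw [Set.disjoint_left]; intro x hx hx'; linarith [hx.2, hx'.1]), Ioc_union_Ioc_eq_Ioc hδ.le hδ'.le]
    have Tb : ∀ θ, Adm θ → ∀ s, ∀ τ ∈ Ioc δ π, I θ s τ ≤ ENNReal.ofReal (2/δ * (2*π)) := by
      intro θ hθ s τ hτ
      simp only [hI]
      rw [← ENNReal.ofReal_mul (kap_nonneg _)]
      apply ENNReal.ofReal_le_ofReal
      have h1 : kap τ ≤ 2/δ := (kap_le (hδ.trans hτ.1)).trans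
        (div_le_div_of_nonneg_left (by norm_num) hδ hτ.1.le)
      have h2 : θ (s + τ) ≤ θ (s - τ) + 2*π := by
        rw [← hθ.per]; exact hθ.mono (by linarith [hτ.2])
      have h3 : θ (s - τ) ≤ θ (s + τ) := hθ.mono (by linarith [hτ.1])
      exact mul_le_mul h1 (by linarith) (by linarith) (by positivity)
    have Tfin : ∀ θ, Adm θ → ∀ s, ∫⁻ τ in Ioc δ π, I θ s τ ≠ ⊤ := by
      intro θ hθ s
      refine ne_top_of_le_ne_top ?_ (setLIntegral_mono measurable_const (Tb θ hθ s))
      rw [setLIntegral_const, Real.volume_Ioc]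
      exact ENNReal.mul_ne_top ENNReal.ofReal_ne_top ENNReal.ofReal_ne_top
    have Tlim : ∀ s, Tendsto (fun n => ∫⁻ τ in Ioc δ π, I (θ n) s τ) atTop
        (𝓝 (∫⁻ τ in Ioc δ π, I ψ s τ)) := by
      intro s
      refine tendsto_lintegral_of_dominated_convergence (fun _ => ENNReal.ofReal (2/δ * (2*π)))
        (fun n => ?_) (fun n => ?_) ?_ ?_
      · have := hmθ n
        simp only [hI]; fun_prop
      · exact (ae_restrict_iff' measurableSet_Ioc).2 (Eventually.of_forall fun τ hτ =>
          Tb _ (h n).1 s τ hτ)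
      · rw [setLIntegral_const, Real.volume_Ioc]
        exact ENNReal.mul_ne_top ENNReal.ofReal_ne_top ENNReal.ofReal_ne_top
      · refine ae_restrict_of_ae ?_
        filter_upwards [ae_cont2 hψ s] with τ hτ
        exact ENNReal.Tendsto.const_mul
            (ENNReal.tendsto_ofReal ((ht _ hτ.1).sub (ht _ hτ.2))) (Or.inr ENNReal.ofReal_ne_top)
    calc _ ≤ ∫⁻ s in Ioc 0 (2*π), liminf (fun n => ∫⁻ τ in Ioc 0 δ, I (θ n) s τ) atTop := by
          refine lintegral_mono_ae (ae_restrict_of_ae ?_)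
          filter_upwards [ae_all_iff.2 (fun n => (h n).2), ae_cont hψ] with s hs hcs
          have l1 : Tendsto (fun n => ENNReal.ofReal (F (θ n s) + c n) -
              ∫⁻ τ in Ioc δ π, I (θ n) s τ) atTop
              (𝓝 (ENNReal.ofReal (F (ψ s) + d) - ∫⁻ τ in Ioc δ π, I ψ s τ)) :=
            ENNReal.Tendsto.sub (ENNReal.tendsto_ofReal
              (((hF.tendsto _).comp (ht s hcs)).add hc)) (Tlim s) (Or.inl ENNReal.ofReal_ne_top)
          calc _ ≤ ENNReal.ofReal (F (ψ s) + d) - ∫⁻ τ in Ioc δ π, I ψ s τ := by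
                apply tsub_le_tsub_left
                rw [split]; exact le_add_self
            _ = _ := l1.liminf_eq.symm
            _ ≤ _ := by
              refine liminf_le_liminf (Eventually.of_forall fun n => ?_)
              have := hs n
              rw [split] at this
              exact tsub_le_iff_right.2 this
      _ ≤ liminf (fun n => ∫⁻ s in Ioc 0 (2*π), ∫⁻ τ in Ioc 0 δ, I (θ n) s τ) atTop :=
          lintegral_liminf_le fun n => Measurable.lintegral_prod_right (meas2 (h n).1)
      _ ≤ liminf (fun _ : ℕ => ENNReal.ofReal (8 * π * δ)) atTop :=
          liminf_le_liminf (Eventually.of_forall fun n => int_small (h n).1)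
      _ = _ := by simp
  have zero : ∫⁻ s in Ioc 0 (2*π), (ENNReal.ofReal (F (ψ s) + d) - V ψ s) = 0 := by
    have hl : Tendsto (fun δ : ℝ => ENNReal.ofReal (8 * π * δ)) (𝓝[>] 0) (𝓝 0) := by
      have : Tendsto (fun δ : ℝ => ENNReal.ofReal (8 * π * δ)) (𝓝 0) (𝓝 (ENNReal.ofReal (8 * π * 0))) :=
        ENNReal.tendsto_ofReal ((continuous_const.mul continuous_id).tendsto _)
      simp only [mul_zero, ENNReal.ofReal_zero] at this
      exact this.mono_left nhdsWithin_le_nhds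
    refine le_antisymm (ge_of_tendsto hl ?_) zero_le
    filter_upwards [Ioo_mem_nhdsGT hpi] with δ hδ using main δ hδ.1 hδ.2
  have hVm := measurable_V hψ
  rw [lintegral_eq_zero_iff (by have := hF.measurable; fun_prop)] at zero
  refine ae_of_periodic (fun s => ?_) 0 ?_
  · rw [hψ.per, hFp, V_per hψ]
  · rw [zero_add]
    filter_upwards [(ae_restrict_iff' measurableSet_Ioc).1 zero] with s hs hs2
    exact tsub_eq_zero_iff_le.1 (hs hs2)

lemma exists_max {F : ℝ → ℝ} (hF : Continuous F) (hFp : Function.Periodic F (2*π))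
    {B : ℝ} (hB : ∀ x, |F x| ≤ B) :
    ∃ θ c, Feas F θ c ∧ ∀ θ' c', Feas F θ' c' → c' ≤ c := by
  have hpi := Real.pi_pos
  set S := {c | ∃ θ, Feas F θ c} with hS
  have hne : S.Nonempty := ⟨-B, fun x => x, Adm.id, Eventually.of_forall fun s => by
    rw [ENNReal.ofReal_eq_zero.2 (by linarith [(abs_le.1 (hB s)).2])]; exact zero_le⟩
  have hbd : BddAbove S := by
    refine ⟨B + 4 * π, ?_⟩
    rintro c ⟨θ, hθ, h⟩
    have h1 : ENNReal.ofReal (c - B) * ENNReal.ofReal (2*π) ≤ ENNReal.ofReal (8 * π * π) := by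
      refine le_trans ?_ (V_lint hθ)
      have e : ∫⁻ s in Ioc 0 (2*π), ENNReal.ofReal (c - B) = ENNReal.ofReal (c - B) * ENNReal.ofReal (2*π) := by
        rw [setLIntegral_const, Real.volume_Ioc, sub_zero]
      rw [← e]
      refine lintegral_mono_ae (ae_restrict_of_ae ?_)
      filter_upwards [h] with s hs
      exact le_trans (ENNReal.ofReal_le_ofReal (by linarith [(abs_le.1 (hB (θ s))).1])) hs
    by_contra hcon
    rw [not_le] at hcon
    rw [← ENNReal.ofReal_mul (by linarith), ENNReal.ofReal_le_ofReal_iff (by positivity)] at h1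
    nlinarith
  obtain ⟨u, -, hu, hu2⟩ := exists_seq_tendsto_sSup hne hbd
  choose θ0 hθ0 using hu2
  have hnorm : ∀ n, ∃ θ, Feas F θ (u n) ∧ θ 0 ∈ Icc 0 (2*π) := by
    intro n
    obtain ⟨m, y, hy, hm⟩ := exists_rep 0 (θ0 n 0)
    refine ⟨fun x => θ0 n x - m * (2*π), ⟨⟨fun x y hxy => ?_, fun x => ?_⟩, ?_⟩, ?_⟩
    · have := (hθ0 n).1.mono hxy; linarith
    · have := (hθ0 n).1.per x; linarith
    · filter_upwards [(hθ0 n).2] with s hs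
      have e : F (θ0 n s - m * (2*π)) = F (θ0 n s) := hFp.sub_int_mul_eq m
      rw [e]
      unfold V at hs ⊢
      simpa using hs
    · constructor <;> linarith [hy.1, hy.2]
  choose θ hθ hθ0 using hnorm
  obtain ⟨φ, ψ, hφ, hψ, ht⟩ := helly (fun n => (hθ n).1) hθ0
  refine ⟨ψ, sSup S, feas_limit hF hFp (fun n => hθ (φ n)) hψ (hu.comp hφ.tendsto_atTop) ht,
    fun θ' c' h' => le_csSup hbd ⟨θ', h'⟩⟩



lemma exists_star {θ : ℝ → ℝ} (h : Monotone θ) {a b p : ℝ} (hab : a < b) (hp : θ a ≤ p) :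
    ∃ t₀ ∈ Icc a b, ∀ t ∈ Icc a b, (t < t₀ → θ t ≤ p) ∧ (t₀ < t → p ≤ θ t) := by
  set T := {t | t ∈ Icc a b ∧ θ t ≤ p} with hT
  have ha : a ∈ T := ⟨⟨le_rfl, hab.le⟩, hp⟩
  have hb : BddAbove T := ⟨b, fun t ht => ht.1.2⟩
  refine ⟨sSup T, ⟨le_csSup hb ha, csSup_le ⟨a, ha⟩ fun t ht => ht.1.2⟩, fun t ht => ⟨fun h1 => ?_, fun h1 => ?_⟩⟩
  · obtain ⟨t', ht', h2⟩ := exists_lt_of_lt_csSup ⟨a, ha⟩ h1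
    exact (h h2.le).trans ht'.2
  · by_contra hcon
    exact absurd (le_csSup hb ⟨ht, (not_le.1 hcon).le⟩) (not_le.2 h1)

lemma cheb {θ φ : ℝ → ℝ} (h : Monotone θ) {a b p : ℝ} (hab : a < b) (hp : θ a ≤ p)
    (hpm : ∫ t in a..b, (p - θ t) = 0) (hφ : AntitoneOn φ (Icc a b))
    (hi : IntervalIntegrable (fun t => φ t * (p - θ t)) volume a b) :
    0 ≤ ∫ t in a..b, φ t * (p - θ t) := by
  obtain ⟨t₀, ht₀, hs⟩ := exists_star h hab hp
  have hi2 : IntervalIntegrable (fun t => φ t₀ * (p - θ t)) volume a b :=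
    (intervalIntegrable_const.sub h.intervalIntegrable).const_mul _
  have e : ∫ t in a..b, φ t * (p - θ t) = ∫ t in a..b, (φ t * (p - θ t) - φ t₀ * (p - θ t)) := by
    rw [intervalIntegral.integral_sub hi hi2, intervalIntegral.integral_const_mul, hpm]; simp
  rw [e]
  refine intervalIntegral.integral_nonneg hab.le fun t ht => ?_
  rw [← sub_mul]
  rcases lt_trichotomy t t₀ with h1 | h1 | h1
  · exact mul_nonneg (sub_nonneg.2 (hφ ht ht₀ h1.le)) (sub_nonneg.2 ((hs t ht).1 h1))
  · simp [h1]
  · exact mul_nonneg_of_nonpos_of_nonpos (sub_nonpos.2 (hφ ht₀ ht h1.le)) (sub_nonpos.2 ((hs t ht).2 h1))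

lemma gpos {θ : ℝ → ℝ} (h : Monotone θ) {a b p : ℝ} (hab : a < b) (hp : θ a ≤ p)
    (hpm : ∫ t in a..b, (p - θ t) = 0) :
    0 < ∫ t in a..b, (-t / 2) * (p - θ t) ∨ ∀ t ∈ Ioo a b, θ t = p := by
  obtain ⟨t₀, ht₀, hs⟩ := exists_star h hab hp
  have hi0 : IntervalIntegrable (fun t => p - θ t) volume a b :=
    (intervalIntegrable_const.sub h.intervalIntegrable)
  have hi2 : IntervalIntegrable (fun t => (t₀ / 2) * (p - θ t)) volume a b := hi0.const_mul _
  have hi : IntervalIntegrable (fun t => (-t/2) * (p - θ t)) volume a b :=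
    hi0.continuousOn_mul (by fun_prop)
  have e : ∫ t in a..b, (-t/2) * (p - θ t) = ∫ t in a..b, ((t₀ / 2) * (p - θ t) + (-t/2) * (p - θ t)) := by
    rw [intervalIntegral.integral_add hi2 hi, intervalIntegral.integral_const_mul, hpm]; simp
  have nn : ∀ t ∈ Icc a b, 0 ≤ (t₀ / 2) * (p - θ t) + (-t/2) * (p - θ t) := by
    intro t ht
    rw [← add_mul]
    rcases lt_trichotomy t t₀ with h1 | h1 | h1
    · exact mul_nonneg (by linarith) (sub_nonneg.2 ((hs t ht).1 h1))
    · rw [h1]; ring_nf; rfl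
    · exact mul_nonneg_of_nonpos_of_nonpos (by linarith) (sub_nonpos.2 ((hs t ht).2 h1))
  have h0 := intervalIntegral.integral_nonneg (μ := volume) hab.le nn
  rw [← e] at h0
  rcases h0.lt_or_eq with h1 | h1
  · exact Or.inl h1
  right
  rw [e] at h1
  have hae := (intervalIntegral.integral_eq_zero_iff_of_le_of_nonneg_ae hab.le
    ((ae_restrict_iff' measurableSet_Ioc).2 (Eventually.of_forall fun t ht => nn t ⟨ht.1.le, ht.2⟩))
    (hi2.add hi)).1 h1.symm
  have hae2 : ∀ᵐ t, t ∈ Ioo a b → θ t = p := by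
    have hne : ∀ᵐ t : ℝ, t ≠ t₀ := by simp [ae_iff]
    filter_upwards [(ae_restrict_iff' measurableSet_Ioc).1 hae, hne] with t ht hn hm
    have := ht ⟨hm.1, hm.2.le⟩
    simp only [Pi.zero_apply] at this
    rw [← add_mul, mul_eq_zero] at this
    rcases this with h | h
    · exact absurd (by linarith) hn
    · linarith
  have ex : ∀ x y, x < y → a ≤ x → y ≤ b → ∃ t ∈ Ioo x y, θ t = p := by
    intro x y hxy hx hy
    by_contra hcon
    push Not at hcon
    have : volume (Ioo x y) = 0 := by
      refine measure_mono_null (fun t ht => ?_) hae2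
      simp only [mem_compl_iff, mem_ofPred_eq, Classical.not_imp]
      exact ⟨⟨hx.trans_lt ht.1, ht.2.trans_le hy⟩, hcon t ht⟩
    simp at this; linarith
  intro t ht
  obtain ⟨x, hx, ex1⟩ := ex a t ht.1 le_rfl ht.2.le
  obtain ⟨y, hy, ey1⟩ := ex t b ht.2 ht.1.le le_rfl
  have := h hx.2.le
  have := h hy.1.le
  linarith

lemma gain_eq {θ η : ℝ → ℝ} (h : Adm θ) {a b p s : ℝ} (hab : a < b) 
    (hη : Function.Periodic η (2*π)) (h1 : ∀ t ∈ Ioo a b, η t = p - θ t)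
    (h0 : ∀ t ∈ Icc b (a + 2*π), η t = 0) (hs : s ∈ Ioo (b - 2*π) a) :
    Integrable (fun τ => kap τ * (η (s + τ) - η (s - τ))) ∧
    IntervalIntegrable (fun t => Real.cot ((t - s)/2) * (p - θ t)) volume a b ∧
    ∫ τ, kap τ * (η (s + τ) - η (s - τ)) = ∫ t in a..b, Real.cot ((t - s)/2) * (p - θ t) := by
  have hpi := Real.pi_pos
  obtain ⟨hs1, hs2⟩ := hs
  set E : ℝ → ℝ := fun t => Real.cot ((t - s)/2) * η t with hE
  have hsin : ∀ t ∈ Icc a b, 0 < Real.sin ((t-s)/2) := fun t ht =>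
    Real.sin_pos_of_pos_of_lt_pi (by linarith [ht.1]) (by linarith [ht.2])
  have i1 : IntervalIntegrable (fun t => Real.cot ((t - s)/2) * (p - θ t)) volume a b := by
    refine IntervalIntegrable.continuousOn_mul
      (intervalIntegrable_const.sub h.mono.intervalIntegrable) ?_
    rw [uIcc_of_le hab.le]
    intro t ht
    have := hasDerivAt_cot (hsin t ht).ne'
    exact (ContinuousAt.comp (g := fun x => Real.cot (x/2)) (f := fun t => t - s)
      this.continuousAt (by fun_prop)).continuousWithinAt
  have c1 : ∀ᵐ t, t ∈ Ioc a b → Real.cot ((t - s)/2) * (p - θ t) = E t := by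
    have hne : ∀ᵐ t : ℝ, t ≠ b := by simp [ae_iff]
    filter_upwards [hne] with t hn ht
    simp only [hE]; rw [h1 t ⟨ht.1, lt_of_le_of_ne ht.2 hn⟩]
  have z1 : ∀ t ∈ Ioc s a, E t = 0 := fun t ht => by
    simp only [hE]; rw [← hη t, h0 _ ⟨by linarith [ht.1], by linarith [ht.2]⟩, mul_zero]
  have z2 : ∀ t ∈ Ioc b (s + 2*π), E t = 0 := fun t ht => by
    simp only [hE]; rw [h0 _ ⟨by linarith [ht.1], by linarith [ht.2]⟩, mul_zero]
  have I1 : IntervalIntegrable E volume s a := by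
    refine (IntervalIntegrable.zero).congr_ae ?_
    rw [uIoc_of_le hs2.le]
    exact (ae_restrict_iff' measurableSet_Ioc).2 (Eventually.of_forall fun t ht => (z1 t ht).symm)
  have I2 : IntervalIntegrable E volume a b := by
    refine i1.congr_ae ?_
    rw [uIoc_of_le hab.le]
    exact (ae_restrict_iff' measurableSet_Ioc).2 c1
  have I3 : IntervalIntegrable E volume b (s + 2*π) := by
    refine (IntervalIntegrable.zero).congr_ae ?_
    rw [uIoc_of_le (by linarith)]
    exact (ae_restrict_iff' measurableSet_Ioc).2 (Eventually.of_forall fun t ht => (z2 t ht).symm)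
  have Itot : ∫ t in s..(s+2*π), E t = ∫ t in a..b, Real.cot ((t - s)/2) * (p - θ t) := by
    rw [← intervalIntegral.integral_add_adjacent_intervals (I1.trans I2) I3,
      ← intervalIntegral.integral_add_adjacent_intervals I1 I2]
    have e1 : ∫ t in s..a, E t = 0 := by
      rw [intervalIntegral.integral_of_le hs2.le, setIntegral_congr_fun measurableSet_Ioc z1]; simp
    have e3 : ∫ t in b..(s+2*π), E t = 0 := by
      rw [intervalIntegral.integral_of_le (by linarith), setIntegral_congr_fun measurableSet_Ioc z2]; simp
    have e2 : ∫ t in a..b, E t = ∫ t in a..b, Real.cot ((t - s)/2) * (p - θ t) := by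
      rw [intervalIntegral.integral_of_le hab.le, intervalIntegral.integral_of_le hab.le]
      exact (setIntegral_congr_ae measurableSet_Ioc c1).symm
    rw [e1, e2, e3]; ring
  have IE : IntervalIntegrable E volume s (s+2*π) := (I1.trans I2).trans I3
  -- the two halves
  have J1 : IntervalIntegrable (fun τ => E (s + τ)) volume 0 π := by
    have : IntervalIntegrable E volume s (s + π) := IE.mono_set (by
      rw [uIcc_of_le (by linarith), uIcc_of_le (by linarith)]; exact Icc_subset_Icc le_rfl (by linarith))
    have := this.comp_add_left s
    simpa using this
  have J2 : IntervalIntegrable (fun τ => E (s + 2*π - τ)) volume 0 π := by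
    have : IntervalIntegrable E volume (s + 2*π) (s + π) := (IE.mono_set (by
      rw [uIcc_of_ge (by linarith), uIcc_of_le (by linarith)]; exact Icc_subset_Icc (by linarith) (by linarith)))
    have := this.comp_sub_left (s + 2*π)
    simp only [sub_self] at this
    rwa [show s + 2*π - (s+π) = π by ring] at this
  have eqD : ∀ τ ∈ Ioc 0 π, kap τ * (η (s + τ) - η (s - τ)) = E (s + τ) + E (s + 2*π - τ) := by
    intro τ hτ
    simp only [hE]
    rw [kap_of hτ.1 hτ.2, show s + 2*π - τ = s - τ + 2*π by ring, hη, show s + τ - s = τ by ring,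
      show (s - τ + 2*π - s)/2 = π - τ/2 by ring]
    have : Real.cot (π - τ/2) = - Real.cot (τ/2) := by
      simp [Real.cot_eq_cos_div_sin, neg_div]
    rw [this]; ring
  have J : IntervalIntegrable (fun τ => kap τ * (η (s + τ) - η (s - τ))) volume 0 π := by
    refine (J1.add J2).congr_ae ?_
    rw [uIoc_of_le hpi.le]
    exact (ae_restrict_iff' measurableSet_Ioc).2 (Eventually.of_forall fun t ht => (eqD t ht).symm)
  have hz : ∀ τ, τ ∉ Ioc 0 π → kap τ * (η (s + τ) - η (s - τ)) = 0 := by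
    intro τ hτ
    have : kap τ = 0 := by
      rcases le_or_gt τ 0 with h | h
      · exact kap_zero' h
      · exact kap_zero (le_of_not_ge fun h2 => hτ ⟨h, h2⟩)
    simp [this]
  refine ⟨?_, i1, ?_⟩
  · rw [intervalIntegrable_iff_integrableOn_Ioc_of_le hpi.le] at J
    exact J.integrable_of_forall_notMem_eq_zero hz
  · rw [← setIntegral_eq_integral_of_forall_compl_eq_zero hz,
      setIntegral_congr_fun measurableSet_Ioc eqD, ← intervalIntegral.integral_of_le hpi.le,
      intervalIntegral.integral_add J1 J2, intervalIntegral.integral_comp_add_left (fun x => E x) s,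
      intervalIntegral.integral_comp_sub_left (fun x => E x) (s + 2*π), ← Itot,
      add_zero, sub_zero, show s + 2*π - π = s + π by ring]
    refine intervalIntegral.integral_add_adjacent_intervals ?_ ?_
    · exact IE.mono_set (by
        rw [uIcc_of_le (by linarith), uIcc_of_le (by linarith)]; exact Icc_subset_Icc le_rfl (by linarith))
    · exact IE.mono_set (by
        rw [uIcc_of_le (by linarith), uIcc_of_le (by linarith)]; exact Icc_subset_Icc (by linarith) le_rfl)

lemma gain_ge {θ η : ℝ → ℝ} (h : Adm θ) {a b p s : ℝ} (hab : a < b) (hp : θ a ≤ p)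
    (hpm : ∫ t in a..b, (p - θ t) = 0) 
    (hη : Function.Periodic η (2*π)) (h1 : ∀ t ∈ Ioo a b, η t = p - θ t)
    (h0 : ∀ t ∈ Icc b (a + 2*π), η t = 0) (hs : s ∈ Ioo (b - 2*π) a) :
    ∫ t in a..b, (-t / 2) * (p - θ t) ≤ ∫ τ, kap τ * (η (s + τ) - η (s - τ)) := by
  obtain ⟨-, i1, e⟩ := gain_eq h hab hη h1 h0 hs
  rw [e]
  have hi0 : IntervalIntegrable (fun t => p - θ t) volume a b :=
    (intervalIntegrable_const.sub h.mono.intervalIntegrable)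
  have i2 : IntervalIntegrable (fun t => ((t - s)/2) * (p - θ t)) volume a b :=
    hi0.continuousOn_mul (by fun_prop)
  have i3 : IntervalIntegrable (fun t => (-t/2) * (p - θ t)) volume a b :=
    hi0.continuousOn_mul (by fun_prop)
  have := cheb h.mono hab hp hpm (φ := fun t => Real.cot ((t-s)/2) + (t-s)/2) (by
    intro x hx y hy hxy
    exact cot_anti (a := x - s) (b := y - s) ⟨by linarith [hx.1, hs.2], by linarith [hx.2, hs.1]⟩
      ⟨by linarith [hy.1, hs.2], by linarith [hy.2, hs.1]⟩ (by linarith)) (by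
    simp_rw [add_mul]; exact i1.add i2)
  simp_rw [add_mul] at this
  rw [intervalIntegral.integral_add i1 i2] at this
  have e2 : ∫ t in a..b, ((t - s)/2) * (p - θ t) = - ∫ t in a..b, (-t / 2) * (p - θ t) := by
    have e3 : ∀ t, ((t - s)/2) * (p - θ t) = (-(s/2)) * (p - θ t) - (-t / 2) * (p - θ t) := by
      intro t; ring
    simp_rw [e3]
    rw [intervalIntegral.integral_sub (hi0.const_mul _) i3, intervalIntegral.integral_const_mul, hpm]
    simp
  linarith

lemma mono_of {g : ℝ → ℝ} {a : ℝ} (hg : ∀ x, g (x + 2*π) = g x + 2*π)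
    (hm : MonotoneOn g (Ioc a (a + 2*π))) (ha : ∀ t ∈ Ioc a (a + 2*π), g a ≤ g t) : Monotone g := by
  have hpi := Real.two_pi_pos
  have hgi : ∀ x (m : ℤ), g (x + m * (2*π)) = g x + m * (2*π) := by
    have : Function.Periodic (fun x => g x - x) (2*π) := by intro x; simp only [hg]; ring
    intro x m
    have := this.int_mul m x
    linarith
  intro x y hxy
  obtain ⟨i, x0, hx0, rfl⟩ := exists_rep a x
  obtain ⟨j, y0, hy0, rfl⟩ := exists_rep a y
  rw [hgi, hgi]
  rcases lt_trichotomy i j with h | h | h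
  · have h1 : (i:ℝ) + 1 ≤ j := by exact_mod_cast h
    have h2 := hm hx0 ⟨by linarith, le_rfl⟩ hx0.2
    rw [hg] at h2
    have := ha y0 hy0
    nlinarith
  · subst h
    have := hm hx0 hy0 (by linarith)
    linarith
  · have h1 : (j:ℝ) + 1 ≤ i := by exact_mod_cast h
    nlinarith [hx0.1, hy0.2]

lemma exists_sweep {θ : ℝ → ℝ} (h : Adm θ) {a b p : ℝ} (hab : a < b) (hb : b < a + 2*π)
    (hpa : θ a ≤ p) (hpb : p ≤ θ b) : ∃ η : ℝ → ℝ, Adm (fun t => θ t + η t) ∧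
      Function.Periodic η (2*π) ∧ (∀ t ∈ Ioo a b, η t = p - θ t) ∧
      (∀ t ∈ Icc b (a + 2*π), η t = 0) := by
  have hpi := Real.two_pi_pos
  set θ' : ℝ → ℝ := fun t => if toIocMod hpi a t < b then p + toIocDiv hpi a t * (2*π) else θ t with hθ'
  have hper : ∀ x, θ' (x + 2*π) = θ' x + 2*π := by
    intro x
    simp only [hθ', toIocMod_add_right, toIocDiv_add_right, h.per]
    split_ifs
    · push_cast; ring
    · rfl
  have hin : ∀ t ∈ Ioo a b, θ' t = p := by
    intro t ht
    have hm : t ∈ Ioc a (a + 2*π) := ⟨ht.1, by linarith [ht.2]⟩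
    have e1 := (toIocMod_eq_self hpi).2 hm
    have e2 : toIocDiv hpi a t = 0 := toIocDiv_eq_of_sub_zsmul_mem_Ioc hpi (by simpa using hm)
    simp only [hθ', e1, e2, ht.2, if_true]; simp
  have hout : ∀ t ∈ Icc b (a + 2*π), θ' t = θ t := by
    intro t ht
    have hm : t ∈ Ioc a (a + 2*π) := ⟨by linarith [ht.1], ht.2⟩
    have e1 := (toIocMod_eq_self hpi).2 hm
    simp only [hθ', e1, not_lt.2 ht.1, if_false]
  have ha : θ' a = θ a := by
    have := hper a
    rw [hout _ ⟨by linarith, le_rfl⟩, h.per] at this; linarith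
  refine ⟨fun t => θ' t - θ t, ⟨?_, ?_⟩, ?_, fun t ht => by dsimp only; rw [hin t ht], fun t ht => by dsimp only; rw [hout t ht, sub_self]⟩
  · have e : (fun t => θ t + (θ' t - θ t)) = θ' := by ext; ring
    rw [e]
    refine mono_of hper (a := a) ?_ ?_
    · intro x hx y hy hxy
      rcases lt_or_ge x b with h1 | h1
      · rw [hin x ⟨hx.1, h1⟩]
        rcases lt_or_ge y b with h2 | h2
        · rw [hin y ⟨hy.1, h2⟩]
        · rw [hout y ⟨h2, hy.2⟩]; exact hpb.trans (h.mono h2)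
      · rw [hout x ⟨h1, hx.2⟩, hout y ⟨h1.trans hxy, hy.2⟩]; exact h.mono hxy
    · intro t ht
      rw [ha]
      rcases lt_or_ge t b with h2 | h2
      · rw [hin t ⟨ht.1, h2⟩]; exact hpa
      · rw [hout t ⟨h2, ht.2⟩]; exact h.mono ht.1.le
  · intro x; have := hper x; dsimp only; linarith
  · intro x; simp only [hper, h.per]; ring



lemma V_combo {θ η : ℝ → ℝ} (_h : Adm θ) (h' : Adm (fun t => θ t + η t)) {ε : ℝ} (h0 : 0 ≤ ε) (h1 : ε ≤ 1)
    (s : ℝ) : ENNReal.ofReal (1 - ε) * V θ s ≤ V (fun t => θ t + ε * η t) s := by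
  unfold V
  rw [← lintegral_const_mul' _ _ ENNReal.ofReal_ne_top]
  refine lintegral_mono fun τ => ?_
  dsimp only
  rcases le_or_gt τ 0 with hτ | hτ
  · simp [kap_zero' hτ]
  rw [mul_left_comm]
  gcongr
  rw [← ENNReal.ofReal_mul (by linarith)]
  apply ENNReal.ofReal_le_ofReal
  have : θ (s - τ) + η (s - τ) ≤ θ (s + τ) + η (s + τ) := h'.mono (by linarith)
  nlinarith

lemma adm_combo {θ η : ℝ → ℝ} (h : Adm θ) (h' : Adm (fun t => θ t + η t)) {ε : ℝ} (h0 : 0 ≤ ε) (h1 : ε ≤ 1) :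
    Adm (fun t => θ t + ε * η t) := by
  refine ⟨fun x y hxy => ?_, fun x => ?_⟩
  · have := h.mono hxy
    have h2 : θ x + η x ≤ θ y + η y := h'.mono hxy
    nlinarith
  · have := h.per x
    have h2 : θ (x + 2*π) + η (x+2*π) = θ x + η x + 2*π := h'.per x
    have : η (x + 2*π) = η x := by linarith
    rw [this, h.per]; ring

lemma V_real {θ : ℝ → ℝ} (_h : Adm θ) (s : ℝ) :
    V θ s = ∫⁻ τ, ENNReal.ofReal (kap τ * (θ (s + τ) - θ (s - τ))) := by
  unfold V
  congr 1; ext τ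
  rw [ENNReal.ofReal_mul (kap_nonneg τ)]

lemma V_nn {θ : ℝ → ℝ} (h : Adm θ) (s τ : ℝ) : 0 ≤ kap τ * (θ (s + τ) - θ (s - τ)) := by
  rcases le_or_gt τ 0 with hτ | hτ
  · simp [kap_zero' hτ]
  · exact mul_nonneg (kap_nonneg τ) (sub_nonneg.2 (h.mono (by linarith)))

lemma V_integrable {θ : ℝ → ℝ} (h : Adm θ) {s : ℝ} (hs : V θ s ≠ ⊤) :
    Integrable (fun τ => kap τ * (θ (s + τ) - θ (s - τ))) := by
  have h1 := h.mono.measurable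
  have h2 := measurable_kap
  refine ⟨by apply Measurable.aestronglyMeasurable; fun_prop, ?_⟩
  rw [hasFiniteIntegral_iff_ofReal (Eventually.of_forall (V_nn h s)), ← V_real h]
  exact hs.lt_top

lemma V_gain {θ η : ℝ → ℝ} (h : Adm θ) (h' : Adm (fun t => θ t + η t)) {ε g : ℝ} (h0 : 0 < ε) (h1 : ε < 1)
    {s : ℝ} (hi : Integrable (fun τ => kap τ * (η (s + τ) - η (s - τ)))) (hg : 0 ≤ g)
    (hge : g ≤ ∫ τ, kap τ * (η (s + τ) - η (s - τ))) :
    V θ s + ENNReal.ofReal (ε * g) ≤ V (fun t => θ t + ε * η t) s := by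
  by_cases hs : V θ s = ⊤
  · have := V_combo h h' h0.le h1.le s
    rw [hs, ENNReal.mul_top (by simp [h1])] at this
    exact le_top.trans this
  have i1 := V_integrable h hs
  have hA := adm_combo h h' h0.le h1.le
  have e : ∀ τ, kap τ * ((θ (s + τ) + ε * η (s + τ)) - (θ (s - τ) + ε * η (s - τ))) =
      kap τ * (θ (s + τ) - θ (s - τ)) + ε * (kap τ * (η (s + τ) - η (s - τ))) := fun τ => by ring
  rw [V_real h, V_real hA, ← ofReal_integral_eq_lintegral_ofReal i1 (Eventually.of_forall (V_nn h s)),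
    ← ENNReal.ofReal_add (integral_nonneg (V_nn h s)) (by positivity),
    ← ofReal_integral_eq_lintegral_ofReal]
  · apply ENNReal.ofReal_le_ofReal
    simp_rw [e]
    rw [integral_add i1 (hi.const_mul _), integral_const_mul]
    gcongr
  · simp_rw [e]; exact i1.add (hi.const_mul _)
  · exact Eventually.of_forall (V_nn hA s)

lemma sweep {F : ℝ → ℝ} (hF : UniformContinuous F) (hFp : Function.Periodic F (2*π))
    {B : ℝ} (hB : ∀ x, |F x| ≤ B) {θ : ℝ → ℝ} {c : ℝ} (hf : Feas F θ c)
    (hmax : ∀ θ' c', Feas F θ' c' → c' ≤ c) {a b κ : ℝ} (hab : a < b) (hb : b < a + 2*π) (hκ : 0 < κ)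
    (hsl : ∀ s ∈ Ioo a b, ENNReal.ofReal (F (θ s) + c) + ENNReal.ofReal κ ≤ V θ s) :
    ∃ p, ∀ t ∈ Ioo a b, θ t = p := by
  obtain ⟨h, hfe⟩ := hf
  have hpi := Real.pi_pos
  set p := (b - a)⁻¹ * ∫ t in a..b, θ t with hp
  have hba : 0 < b - a := sub_pos.2 hab
  have hpe : (b - a) * p = ∫ t in a..b, θ t := by rw [hp]; field_simp
  have hpa : θ a ≤ p := by
    have : ∫ t in a..b, θ a ≤ ∫ t in a..b, θ t :=
      intervalIntegral.integral_mono_on hab.le intervalIntegrable_const (adm_ii h a b)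
        fun t ht => h.mono ht.1
    rw [intervalIntegral.integral_const, ← hpe, smul_eq_mul] at this
    exact le_of_mul_le_mul_left this hba
  have hpb : p ≤ θ b := by
    have : ∫ t in a..b, θ t ≤ ∫ t in a..b, θ b :=
      intervalIntegral.integral_mono_on hab.le (adm_ii h a b) intervalIntegrable_const 
        fun t ht => h.mono ht.2
    rw [intervalIntegral.integral_const, ← hpe, smul_eq_mul] at this
    exact le_of_mul_le_mul_left this hba
  have hpm : ∫ t in a..b, (p - θ t) = 0 := by
    rw [intervalIntegral.integral_sub intervalIntegrable_const (adm_ii h a b),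
      intervalIntegral.integral_const, ← hpe, smul_eq_mul, sub_self]
  obtain ⟨η, hA, hηp, hη1, hη0⟩ := exists_sweep h hab hb hpa hpb
  rcases gpos h.mono hab hpa hpm with hg | hg
  swap
  · exact ⟨p, hg⟩
  exfalso
  set g := ∫ t in a..b, (-t / 2) * (p - θ t) with hgdef
  obtain ⟨δ, hδ, hδ2⟩ := Metric.uniformContinuous_iff.1 hF (κ/4) (by positivity)
  have hB0 : 0 ≤ B := (abs_nonneg _).trans (hB 0)
  have hK : 0 < B + |c| + κ := by positivity
  set ε := min (1/2) (min (δ / (4 * π)) (κ / (2 * (B + |c| + κ)))) with hε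
  have hε0 : 0 < ε := by positivity
  have hε1 : ε < 1 := (min_le_left _ _).trans_lt (by norm_num)
  have hε2 : ε * (2 * π) < δ := by
    have : ε ≤ δ / (4*π) := (min_le_right _ _).trans (min_le_left _ _)
    rw [le_div_iff₀ (by positivity)] at this
    linarith
  have hε3 : ε * (B + |c| + κ) ≤ κ / 2 := by
    have : ε ≤ κ / (2 * (B + |c| + κ)) := (min_le_right _ _).trans (min_le_right _ _)
    rw [le_div_iff₀ (by positivity)] at this
    linarith
  have hE := adm_combo h hA hε0.le hε1.le
  have hfeas : Feas F (fun t => θ t + ε * η t) (c + min (ε * g) (κ/4)) := by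
    refine ⟨hE, ae_of_periodic (a := b - 2*π) (fun s => ?_) ?_⟩
    · have e : θ (s + 2*π) + ε * η (s + 2*π) = θ s + ε * η s + 2*π := hE.per s
      rw [V_per hE s]; dsimp only; rw [e, hFp]
    have hna : ∀ᵐ t : ℝ, t ≠ a := by simp [ae_iff]
    have hnb : ∀ᵐ t : ℝ, t ≠ b := by simp [ae_iff]
    filter_upwards [hfe, hna, hnb] with s hs hsa hsb hsm
    rw [sub_add_cancel] at hsm
    rcases lt_or_gt_of_ne hsa with h1 | h1
    · have hz : η s = 0 := by rw [← hηp s]; exact hη0 _ ⟨by linarith [hsm.1], by linarith⟩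
      have hmem : s ∈ Ioo (b - 2*π) a := ⟨hsm.1, h1⟩
      have hV := V_gain h hA hε0 hε1 (gain_eq h hab hηp hη1 hη0 hmem).1 hg.le
        (gain_ge h hab hpa hpm hηp hη1 hη0 hmem)
      rw [hz, mul_zero, add_zero, ← add_assoc]
      calc _ ≤ ENNReal.ofReal (F (θ s) + c) + ENNReal.ofReal (min (ε * g) (κ/4)) := ENNReal.ofReal_add_le
        _ ≤ V θ s + ENNReal.ofReal (ε * g) := by
          gcongr; exact min_le_left _ _
        _ ≤ _ := hV
    · have hmem : s ∈ Ioo a b := ⟨h1, lt_of_le_of_ne hsm.2 hsb⟩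
      have hηb : |η s| ≤ 2 * π := by
        rw [hη1 s hmem]
        have e1 := h.mono hmem.1.le
        have e2 := h.mono hmem.2.le
        have e3 := h.mono hb.le
        rw [h.per] at e3
        rw [abs_le]; constructor <;> linarith
      have hd : dist (θ s + ε * η s) (θ s) < δ := by
        rw [Real.dist_eq, add_sub_cancel_left, abs_mul, abs_of_pos hε0]
        exact lt_of_le_of_lt (by gcongr) hε2
      have hd2 := hδ2 hd
      rw [Real.dist_eq] at hd2
      have hd3 := (abs_lt.1 hd2).2
      refine le_trans ?_ (V_combo h hA hε0.le hε1.le s)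
      refine le_trans ?_ (mul_le_mul_right (hsl s hmem) _)
      have e : ENNReal.ofReal (F (θ s) + c) = ENNReal.ofReal (max (F (θ s) + c) 0) := by simp
      rw [e, ← ENNReal.ofReal_add (le_max_right _ _) hκ.le, ← ENNReal.ofReal_mul (by linarith)]
      apply ENNReal.ofReal_le_ofReal
      have m1 : max (F (θ s) + c) 0 ≤ B + |c| :=
        max_le (add_le_add ((le_abs_self _).trans (hB _)) (le_abs_self _)) (by positivity)
      have m2 := le_max_left (F (θ s) + c) 0
      have m3 := min_le_right (ε * g) (κ/4)
      have m4 : ε * (max (F (θ s) + c) 0 + κ) ≤ κ / 2 :=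
        (mul_le_mul_of_nonneg_left (by linarith) hε0.le).trans hε3
      linarith
  have := hmax _ _ hfeas
  have h3 : 0 < min (ε * g) (κ/4) := by positivity
  linarith

lemma slack {F : ℝ → ℝ} (hF : UniformContinuous F) (hFp : Function.Periodic F (2*π))
    {B : ℝ} (hB : ∀ x, |F x| ≤ B) {θ : ℝ → ℝ} {c : ℝ} (hf : Feas F θ c)
    (hmax : ∀ θ' c', Feas F θ' c' → c' ≤ c) {s₀ : ℝ} (hs : ENNReal.ofReal (F (θ s₀) + c) < V θ s₀) :
    ∃ d > 0, ∃ p, ∀ t ∈ Ioo (s₀ - d) (s₀ + d), θ t = p := by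
  have hpi := Real.pi_pos
  have key : ∃ κ : ℝ, 0 < κ ∧ ∀ᶠ s in 𝓝 s₀, ENNReal.ofReal (F (θ s) + c) + ENNReal.ofReal κ ≤ V θ s := by
    by_cases hc : ContinuousAt θ s₀
    · obtain ⟨r, hr, hr2⟩ := ENNReal.lt_iff_exists_add_pos_lt.1 hs
      have hr' : (0:ℝ) < r := hr
      have hcc : ContinuousAt (fun s => ENNReal.ofReal (F (θ s) + c)) s₀ :=
        ENNReal.continuous_ofReal.continuousAt.comp
          ((hF.continuous.continuousAt.comp hc).add continuousAt_const)
      have h1 : ENNReal.ofReal (F (θ s₀) + c) < ENNReal.ofReal (F (θ s₀) + c) + ENNReal.ofReal (r/2) :=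
        ENNReal.lt_add_right ENNReal.ofReal_ne_top (by simp [hr])
      refine ⟨r/2, by positivity, ?_⟩
      filter_upwards [hcc.eventually_lt continuousAt_const h1, V_lsc hf.1 s₀ _ hr2] with s e1 e2
      calc _ ≤ (ENNReal.ofReal (F (θ s₀) + c) + ENNReal.ofReal (r/2)) + ENNReal.ofReal (r/2) := by gcongr
        _ = ENNReal.ofReal (F (θ s₀) + c) + r := by
          rw [add_assoc, ← ENNReal.ofReal_add (by positivity) (by positivity), add_halves,
            ENNReal.ofReal_coe_nnreal]
        _ ≤ _ := e2.le
    · have ht := V_jump hf.1 hc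
      refine ⟨1, one_pos, ?_⟩
      have h1 : ENNReal.ofReal (B + c) + ENNReal.ofReal 1 < V θ s₀ := by
        rw [ht]; exact (ENNReal.add_ne_top.2 ⟨ENNReal.ofReal_ne_top, ENNReal.ofReal_ne_top⟩).lt_top
      filter_upwards [V_lsc hf.1 s₀ _ h1] with s e
      refine le_trans ?_ e.le
      gcongr
      exact (le_abs_self _).trans (hB _)
  obtain ⟨κ, hκ, hev⟩ := key
  obtain ⟨δ, hδ, hb⟩ := Metric.eventually_nhds_iff.1 hev
  refine ⟨min δ (π/2), by positivity, ?_⟩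
  have m1 := min_le_left δ (π/2)
  have m2 := min_le_right δ (π/2)
  have m3 : 0 < min δ (π/2) := by positivity
  refine sweep hF hFp hB hf hmax (κ := κ) (by linarith) (by linarith) hκ fun s hs => hb ?_
  rw [Real.dist_eq, abs_lt]
  constructor <;> linarith [hs.1, hs.2]

lemma no_plateau {F : ℝ → ℝ} (hF : UniformContinuous F) (hFp : Function.Periodic F (2*π))
    {B : ℝ} (hB : ∀ x, |F x| ≤ B) {θ : ℝ → ℝ} {c : ℝ} (hf : Feas F θ c)
    (hmax : ∀ θ' c', Feas F θ' c' → c' ≤ c) {x y α : ℝ} (hxy : x < y) (hx : θ x = α) (hy : θ y = α) :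
    False := by
  have hpi := Real.pi_pos
  have h := hf.1
  set P := {t | θ t = α} with hP
  have bA : BddAbove P := ⟨x + 2*π, fun t ht => by
    by_contra hcon
    have h1 := h.mono (not_le.1 hcon).le
    rw [h.per] at h1
    have h2 : θ t = α := ht
    linarith⟩
  have bB : BddBelow P := ⟨x - 2*π, fun t ht => by
    by_contra hcon
    have h1 := h.mono (not_le.1 hcon).le
    rw [h.per_sub] at h1
    have h2 : θ t = α := ht
    linarith⟩
  have hne : P.Nonempty := ⟨x, hx⟩
  set a := sInf P with ha
  set b := sSup P with hb
  have hab : a < b := (csInf_le bB (show x ∈ P from hx)).trans_lt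
    (hxy.trans_le (le_csSup bA (show y ∈ P from hy)))
  have hin : ∀ t ∈ Ioo a b, θ t = α := by
    intro t ht
    obtain ⟨q, hq, hq2⟩ := exists_lt_of_lt_csSup hne ht.2
    obtain ⟨r, hr, hr2⟩ := exists_lt_of_csInf_lt hne ht.1
    have h1 := h.mono hq2.le
    have h2 := h.mono hr2.le
    have h3 : θ q = α := hq
    have h4 : θ r = α := hr
    linarith
  have hVb : V θ b ≤ ENNReal.ofReal (F (θ b) + c) := by
    by_contra hcon
    obtain ⟨d, hd, p, hp⟩ := slack hF hFp hB hf hmax (not_le.1 hcon)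
    obtain ⟨t, ht1, ht2⟩ := exists_between (max_lt hab (show b - d < b by linarith))
    have e1 := hin t ⟨(le_max_left _ _).trans_lt ht1, ht2⟩
    have e2 := hp t ⟨(le_max_right _ _).trans_lt ht1, by linarith⟩
    have e3 := hp (b + d/2) ⟨by linarith, by linarith⟩
    have := le_csSup bA (show b + d/2 ∈ P from e3.trans (e2.symm.trans e1))
    linarith
  have hVa : V θ a ≤ ENNReal.ofReal (F (θ a) + c) := by
    by_contra hcon
    obtain ⟨d, hd, p, hp⟩ := slack hF hFp hB hf hmax (not_le.1 hcon)
    obtain ⟨t, ht1, ht2⟩ := exists_between (lt_min hab (show a < a + d by linarith))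
    have e1 := hin t ⟨ht1, ht2.trans_le (min_le_left _ _)⟩
    have e2 := hp t ⟨by linarith, ht2.trans_le (min_le_right _ _)⟩
    have e3 := hp (a - d/2) ⟨by linarith, by linarith⟩
    have := csInf_le bB (show a - d/2 ∈ P from e3.trans (e2.symm.trans e1))
    linarith
  have cb : ContinuousAt θ b := by
    by_contra hcon
    rw [V_jump h hcon, top_le_iff] at hVb
    exact ENNReal.ofReal_ne_top hVb
  have ca : ContinuousAt θ a := by
    by_contra hcon
    rw [V_jump h hcon, top_le_iff] at hVa
    exact ENNReal.ofReal_ne_top hVa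
  have eb : θ b = α := by
    refine tendsto_nhds_unique (cb.tendsto.mono_left (nhdsWithin_le_nhds (s := Iio b)))
      (tendsto_const_nhds.congr' ?_)
    filter_upwards [Ioo_mem_nhdsLT hab] with t ht using (hin t ht).symm
  have ea : θ a = α := by
    refine tendsto_nhds_unique (ca.tendsto.mono_left (nhdsWithin_le_nhds (s := Ioi a)))
      (tendsto_const_nhds.congr' ?_)
    filter_upwards [Ioo_mem_nhdsGT hab] with t ht using (hin t ht).symm
  have hpl : ∀ t ∈ Icc a b, θ t = α := fun t ht =>
    le_antisymm (eb ▸ h.mono ht.2) (ea ▸ h.mono ht.1)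
  have hmx : ∀ t, b < t → α < θ t := fun t ht => by
    refine lt_of_le_of_ne (eb ▸ h.mono ht.le) fun e => ?_
    have := le_csSup bA (show t ∈ P from e.symm)
    linarith
  rw [eb] at hVb
  rw [ea] at hVa
  have : volume (Ioo a b) = 0 := by
    refine measure_mono_null (fun t ht => ?_) hf.2
    simp only [mem_compl_iff, mem_ofPred_eq, not_le]
    rw [hpl t ⟨ht.1.le, ht.2.le⟩]
    exact V_plateau h hab hpl hmx ENNReal.ofReal_ne_top hVa hVb ht
  simp at this; linarith

lemma exists_good {F : ℝ → ℝ} (hF : UniformContinuous F) (hFp : Function.Periodic F (2*π))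
    {B : ℝ} (hB : ∀ x, |F x| ≤ B) : ∃ (θ : ℝ → ℝ) (c : ℝ), Adm θ ∧ StrictMono θ ∧ Continuous θ ∧
      (∀ᵐ s, V θ s = ENNReal.ofReal (F (θ s) + c)) ∧ ∀ s, 0 < F (θ s) + c := by
  obtain ⟨θ, c, hf, hmax⟩ := exists_max hF.continuous hFp hB
  have h := hf.1
  have hst : StrictMono θ := fun x y hxy => lt_of_le_of_ne (h.mono hxy.le) fun e =>
    no_plateau hF hFp hB hf hmax hxy e rfl
  have hle : ∀ s, V θ s ≤ ENNReal.ofReal (F (θ s) + c) := by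
    intro s
    by_contra hcon
    obtain ⟨d, hd, p, hp⟩ := slack hF hFp hB hf hmax (not_le.1 hcon)
    exact no_plateau hF hFp hB hf hmax (show s < s + d/2 by linarith)
      (hp _ ⟨by linarith, by linarith⟩) (hp _ ⟨by linarith, by linarith⟩)
  refine ⟨θ, c, h, hst, continuous_iff_continuousAt.2 fun s => ?_, ?_, fun s => ?_⟩
  · by_contra hcon
    have := hle s
    rw [V_jump h hcon, top_le_iff] at this
    exact ENNReal.ofReal_ne_top this
  · filter_upwards [hf.2] with s hs using le_antisymm (hle s) hs
  · exact ENNReal.ofReal_pos.1 ((V_pos h hst s).trans_le (hle s))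



lemma cot_step {τ : ℝ} (h0 : 0 < τ) (h1 : τ ≤ π) (n : ℕ) :
    kap τ * Real.sin (((n+1 : ℕ):ℝ) * τ) =
      kap τ * Real.sin (n * τ) + (Real.cos (((n+1 : ℕ):ℝ) * τ) + Real.cos (n * τ)) := by
  have hpi := Real.pi_pos
  have hs : Real.sin (τ/2) ≠ 0 := (Real.sin_pos_of_pos_of_lt_pi (by linarith) (by linarith)).ne'
  rw [kap_of h0 h1, Real.cot_eq_cos_div_sin]
  have e1 : ((n+1 : ℕ):ℝ) * τ = (n*τ + τ/2) + τ/2 := by push_cast; ring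
  have e2 : (n:ℝ) * τ = (n*τ + τ/2) - τ/2 := by ring
  rw [e1]
  conv_rhs => rw [e2]
  generalize (n:ℝ) * τ + τ/2 = A
  have e3 : A - τ/2 + τ/2 = A := by ring
  rw [Real.sin_add, Real.cos_add]
  rw [Real.sin_sub, Real.cos_sub]
  field_simp
  ring

lemma int_cos (n : ℕ) : ∫ τ in (0:ℝ)..π, Real.cos (n * τ) = if n = 0 then π else 0 := by
  split_ifs with h
  · simp [h]
  · have : (n:ℝ) ≠ 0 := by exact_mod_cast h
    rw [intervalIntegral.integral_comp_mul_left (fun x => Real.cos x) this]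
    simp [Real.sin_nat_mul_pi]

lemma J (n : ℕ) : IntervalIntegrable (fun τ => kap τ * Real.sin (n * τ)) volume 0 π ∧
    ∫ τ in (0:ℝ)..π, kap τ * Real.sin (n * τ) = if n = 0 then 0 else π := by
  have hpi := Real.pi_pos
  have hc : ∀ n : ℕ, IntervalIntegrable (fun τ => Real.cos (n * τ)) volume 0 π := fun n => by
    apply Continuous.intervalIntegrable; fun_prop
  induction n with
  | zero => simp
  | succ n ih =>
    have ii := ih.1.add ((hc (n+1)).add (hc n))
    refine ⟨ii.congr_ae ?_, ?_⟩
    · rw [uIoc_of_le hpi.le]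
      exact (ae_restrict_iff' measurableSet_Ioc).2
        (Eventually.of_forall fun t ht => (cot_step ht.1 ht.2 n).symm)
    · have e : ∫ τ in (0:ℝ)..π, kap τ * Real.sin (((n+1:ℕ):ℝ) * τ) = ∫ τ in (0:ℝ)..π,
          (kap τ * Real.sin (n * τ) + (Real.cos (((n+1 : ℕ):ℝ) * τ) + Real.cos (n * τ))) := by
        rw [intervalIntegral.integral_of_le hpi.le, intervalIntegral.integral_of_le hpi.le]
        exact setIntegral_congr_fun measurableSet_Ioc fun t ht => cot_step ht.1 ht.2 n
      rw [e, intervalIntegral.integral_add ih.1 ((hc (n+1)).add (hc n)),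
        intervalIntegral.integral_add (hc (n+1)) (hc n), ih.2, int_cos, int_cos]
      by_cases h : n = 0 <;> simp [h]

lemma Jz (k : ℤ) : ∫ τ, kap τ * Real.sin (k * τ) = π * (k.sign : ℝ) := by
  have hpi := Real.pi_pos
  have hz : ∀ τ, τ ∉ Ioc 0 π → kap τ * Real.sin (k * τ) = 0 := by
    intro τ hτ
    have : kap τ = 0 := by
      rcases le_or_gt τ 0 with h | h
      · exact kap_zero' h
      · exact kap_zero (le_of_not_ge fun h2 => hτ ⟨h, h2⟩)
    simp [this]
  rw [← setIntegral_eq_integral_of_forall_compl_eq_zero hz, ← intervalIntegral.integral_of_le hpi.le]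
  obtain ⟨n, rfl | rfl⟩ := k.eq_nat_or_neg
  · have := (J n).2
    push_cast
    rw [this]
    rcases Nat.eq_zero_or_pos n with h | h
    · simp [h]
    · have : (n:ℤ).sign = 1 := Int.sign_eq_one_of_pos (by exact_mod_cast h)
      simp only [Int.sign_neg, this, if_neg h.ne']; simp
  · have := (J n).2
    push_cast
    simp only [neg_mul, Real.sin_neg, mul_neg, intervalIntegral.integral_neg]
    rw [this]
    rcases Nat.eq_zero_or_pos n with h | h
    · simp [h]
    · have : (n:ℤ).sign = 1 := Int.sign_eq_one_of_pos (by exact_mod_cast h)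
      simp only [Int.sign_neg, this, if_neg h.ne']; simp

def ee (k : ℤ) (s : ℝ) : ℂ := Complex.exp (-(Complex.I * k * s))

lemma ee_norm (k : ℤ) (s : ℝ) : ‖ee k s‖ = 1 := by
  have : -(Complex.I * k * s) = ((-(k*s) : ℝ) : ℂ) * Complex.I := by push_cast; ring
  rw [ee, this, Complex.norm_exp_ofReal_mul_I]

lemma ee_cont (k : ℤ) : Continuous (ee k) := by unfold ee; fun_prop

lemma ee_per (k : ℤ) : Function.Periodic (ee k) (2*π) := by
  intro s
  unfold ee
  have : -(Complex.I * k * ((s + 2*π : ℝ):ℂ)) = -(Complex.I * k * s) + ((-k : ℤ):ℂ) * (2 * π * Complex.I) := by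
    push_cast; ring
  rw [this, Complex.exp_add, Complex.exp_int_mul_two_pi_mul_I, mul_one]

lemma ee_add (k : ℤ) (s t : ℝ) : ee k (s + t) = ee k s * ee k t := by
  unfold ee; rw [← Complex.exp_add]; congr 1; push_cast; ring

lemma ee_int {k : ℤ} (hk : k ≠ 0) : ∫ s in (0:ℝ)..(2*π), ee k s = 0 := by
  have hc : -(Complex.I * k) ≠ 0 := by simp [hk]
  have := integral_exp_mul_complex (a := 0) (b := 2*π) hc
  have e : ∀ s : ℝ, ee k s = Complex.exp (-(Complex.I * k) * s) := fun s => by unfold ee; ring_nf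
  simp_rw [e]
  rw [this]
  rw [← e, ← e]
  have := ee_per k 0
  rw [zero_add] at this
  rw [this]; simp

lemma ee_shift {w : ℝ → ℝ} (hw : Function.Periodic w (2*π)) (k : ℤ) (τ : ℝ) :
    ∫ s in (0:ℝ)..(2*π), (w (s + τ) : ℂ) * ee k s = ee k (-τ) * ∫ s in (0:ℝ)..(2*π), (w s : ℂ) * ee k s := by
  have e : ∀ s, (w (s + τ) : ℂ) * ee k s = ee k (-τ) * ((fun x => (w x : ℂ) * ee k x) (s + τ)) := by
    intro s
    have : ee k s = ee k (s + τ) * ee k (-τ) := by rw [← ee_add]; ring_nf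
    dsimp only
    rw [this]; ring
  simp_rw [e]
  rw [intervalIntegral.integral_const_mul]
  congr 1
  rw [intervalIntegral.integral_comp_add_right (fun x => (w x : ℂ) * ee k x) τ]
  have hp : Function.Periodic (fun x => (w x : ℂ) * ee k x) (2*π) := by
    intro x; dsimp only; rw [hw, ee_per]
  have := hp.intervalIntegral_add_eq τ 0
  rw [zero_add, add_comm τ] at *
  simpa using this

lemma inner_int {θ : ℝ → ℝ} (h : Adm θ) (hc : Continuous θ) {k : ℤ} (hk : k ≠ 0) (C τ : ℝ) :
    ∫ s in (0:ℝ)..(2*π), ((θ (s + τ) - θ (s - τ) : ℝ) : ℂ) * ee k s =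
      2 * Complex.I * Real.sin (k * τ) * ∫ s in (0:ℝ)..(2*π), ((θ s - s - C : ℝ) : ℂ) * ee k s := by
  have hek := ee_cont k
  set w : ℝ → ℝ := fun s => θ s - s - C with hw
  have hwc : Continuous w := by fun_prop
  have hwp : Function.Periodic w (2*π) := by intro x; simp only [hw, h.per]; ring
  have e : ∀ s, ((θ (s + τ) - θ (s - τ) : ℝ) : ℂ) * ee k s =
    (w (s + τ) : ℂ) * ee k s - (w (s + -τ) : ℂ) * ee k s + (2 * τ : ℂ) * ee k s := by
    intro s; simp only [hw, ← sub_eq_add_neg]; push_cast; ring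
  simp_rw [e]
  have i1 : ∀ τ, IntervalIntegrable (fun s => (w (s + τ) : ℂ) * ee k s) volume 0 (2*π) := fun τ => by
    apply Continuous.intervalIntegrable; fun_prop
  have i2 : IntervalIntegrable (fun s => (2 * τ : ℂ) * ee k s) volume 0 (2*π) := by
    apply Continuous.intervalIntegrable; fun_prop
  rw [intervalIntegral.integral_add ((i1 τ).sub (i1 (-τ))) i2, intervalIntegral.integral_sub (i1 τ) (i1 (-τ)),
    ee_shift hwp, ee_shift hwp, intervalIntegral.integral_const_mul, ee_int hk, ← sub_mul, mul_zero, add_zero,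
    neg_neg]
  congr 1
  unfold ee
  have a1 : -(Complex.I * k * ((-τ : ℝ) : ℂ)) = (k * τ : ℂ) * Complex.I := by push_cast; ring
  have a2 : -(Complex.I * k * (τ : ℂ)) = (-(k * τ : ℂ)) * Complex.I := by ring
  rw [a1, a2, Complex.exp_mul_I, Complex.exp_mul_I, Complex.cos_neg, Complex.sin_neg]
  push_cast; ring

lemma fourier_V {θ : ℝ → ℝ} (h : Adm θ) (hc : Continuous θ) {k : ℤ} (hk : k ≠ 0) (C : ℝ) :
    ∫ s in (0:ℝ)..(2*π), (((V θ s).toReal : ℝ) : ℂ) * ee k s =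
      2 * Complex.I * π * (k.sign : ℂ) * ∫ s in (0:ℝ)..(2*π), ((θ s - s - C : ℝ) : ℂ) * ee k s := by
  have hpi := Real.pi_pos
  have hm1 := measurable_kap
  have hek := ee_cont k
  have hVr : ∀ s, (V θ s).toReal = ∫ τ, kap τ * (θ (s + τ) - θ (s - τ)) := by
    intro s
    rw [V_real h, integral_eq_lintegral_of_nonneg_ae (Eventually.of_forall (V_nn h s))]
    apply Measurable.aestronglyMeasurable
    fun_prop
  set Φ : ℝ → ℝ → ℂ := fun s τ => ((kap τ * (θ (s + τ) - θ (s - τ)) : ℝ) : ℂ) * ee k s with hΦ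
  have hint : Integrable (Function.uncurry Φ) ((volume.restrict (Ioc 0 (2*π))).prod volume) := by
    refine ⟨?_, ?_⟩
    · apply Measurable.aestronglyMeasurable
      have := hek.measurable
      have := hc.measurable
      simp only [hΦ, Function.uncurry_def]
      fun_prop
    · rw [hasFiniteIntegral_iff_enorm]
      have e : ∀ p : ℝ × ℝ, ‖Function.uncurry Φ p‖ₑ =
          ENNReal.ofReal (kap p.2) * ENNReal.ofReal (θ (p.1 + p.2) - θ (p.1 - p.2)) := by
        intro p
        simp only [hΦ, Function.uncurry_def]
        rw [← ofReal_norm, norm_mul, ee_norm, mul_one, Complex.norm_real, Real.norm_eq_abs,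
          abs_of_nonneg (V_nn h _ _), ENNReal.ofReal_mul (kap_nonneg _)]
      simp_rw [e]
      rw [lintegral_prod _ (meas2 h).aemeasurable]
      exact (V_lint h).trans_lt ENNReal.ofReal_lt_top
  have l1 : ∀ s, (((V θ s).toReal : ℝ) : ℂ) * ee k s = ∫ τ, Φ s τ := by
    intro s
    simp only [hΦ]
    rw [integral_mul_const, hVr, ← integral_complex_ofReal]
  simp_rw [l1]
  rw [intervalIntegral.integral_of_le (by positivity), integral_integral_swap hint]
  have l2 : ∀ τ, ∫ s in Ioc 0 (2*π), Φ s τ = ((kap τ * Real.sin (k * τ) : ℝ) : ℂ) *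
      (2 * Complex.I * ∫ s in (0:ℝ)..(2*π), ((θ s - s - C : ℝ) : ℂ) * ee k s) := by
    intro τ
    rw [← intervalIntegral.integral_of_le (by positivity)]
    have e : ∀ s, Φ s τ = (kap τ : ℂ) * (((θ (s + τ) - θ (s - τ) : ℝ) : ℂ) * ee k s) := by
      intro s; simp only [hΦ]; push_cast; ring
    simp_rw [e]
    rw [intervalIntegral.integral_const_mul, inner_int h hc hk C]
    push_cast; ring
  simp_rw [l2]
  rw [integral_mul_const, integral_complex_ofReal, Jz]
  push_cast; ring

lemma bv_aux {θ : ℝ → ℝ} (h : Monotone θ) (C a b : ℝ) :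
    BoundedVariationOn (fun s => θ s - s - C) (Icc a b) := by
  have h1 : BoundedVariationOn θ (Icc a b) :=
    (h.monotoneOn _).boundedVariationOn (C := |θ a| + |θ b|) fun x hx => by
      have e1 := h hx.1
      have e2 := h hx.2
      rw [abs_le]
      constructor <;> linarith [neg_abs_le (θ a), le_abs_self (θ b), abs_nonneg (θ a), abs_nonneg (θ b)]
  have h2 : BoundedVariationOn id (Icc a b) := BoundedVariationOn.id_Icc a b
  refine ne_top_of_le_ne_top (ENNReal.add_ne_top.2 ⟨h1, h2⟩) (iSup_le ?_)
  rintro ⟨n, u, hu, us⟩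
  refine le_trans ?_ (add_le_add (eVariationOn.sum_le (f := θ) (n := n) hu us)
    (eVariationOn.sum_le (f := id) (n := n) hu us))
  rw [← Finset.sum_add_distrib]
  refine Finset.sum_le_sum fun i _ => ?_
  simp only [edist_dist, Real.dist_eq, id]
  rw [← ENNReal.ofReal_add (abs_nonneg _) (abs_nonneg _)]
  apply ENNReal.ofReal_le_ofReal
  have e : θ (u (i+1)) - u (i+1) - C - (θ (u i) - u i - C) =
    (θ (u (i+1)) - θ (u i)) - (u (i+1) - u i) := by ring
  rw [e]
  exact abs_sub _ _

lemma fourier_ee (k : ℤ) (s : ℝ) : fourier (-k) (s : AddCircle (2*π)) = ee k s := by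
  have hpi : (π:ℂ) ≠ 0 := by exact_mod_cast Real.pi_pos.ne'
  rw [fourier_coe_apply, ee]
  congr 1
  push_cast
  field_simp

lemma fc [Fact ((0 : ℝ) < 2 * π)] (g : AddCircle (2*π) → ℝ) (k : ℤ) :
    fourierCoeff (fun t => (g t : ℂ)) k = (1 / (2*π) : ℝ) • ∫ s in (0:ℝ)..(2*π), (g s : ℂ) * ee k s := by
  rw [fourierCoeff_eq_intervalIntegral _ _ 0, zero_add]
  congr 2
  ext s
  rw [fourier_ee, smul_eq_mul, mul_comm]

lemma exists_homeo [Fact ((0 : ℝ) < 2 * π)] {θ : ℝ → ℝ} (h : Adm θ) (hs : StrictMono θ) (hc : Continuous θ) :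
    ∃ H : AddCircle (2 * π) ≃ₜ AddCircle (2 * π), ∀ s : ℝ, H (s : AddCircle (2*π)) = (θ s : AddCircle (2*π)) := by
  have hpi := Real.two_pi_pos
  have hp : Function.Periodic (fun s => (θ s : AddCircle (2*π))) (2*π) := by
    intro s; dsimp only; rw [h.per, AddCircle.coe_add_period]
  have hsurj : Function.Surjective θ := by
    intro y
    apply mem_range_of_exists_le_of_exists_ge hc
    · obtain ⟨n, hn⟩ := exists_nat_ge ((θ 0 - y) / (2*π))
      rw [div_le_iff₀ hpi] at hn
      refine ⟨0 + ((-n : ℤ) : ℝ) * (2*π), ?_⟩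
      rw [h.per_int]; push_cast; linarith
    · obtain ⟨n, hn⟩ := exists_nat_ge ((y - θ 0) / (2*π))
      rw [div_le_iff₀ hpi] at hn
      refine ⟨0 + ((n : ℤ) : ℝ) * (2*π), ?_⟩
      rw [h.per_int]; push_cast; linarith
  have hcont : Continuous hp.lift := by
    refine continuous_coinduced_dom.2 ?_
    exact (AddCircle.continuous_mk' (2*π)).comp hc
  have hbij : Function.Bijective hp.lift := by
    constructor
    · intro x y
      induction x using QuotientAddGroup.induction_on with | H x => ?_
      induction y using QuotientAddGroup.induction_on with | H y => ?_
      intro e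
      have e : (θ x : AddCircle (2*π)) = (θ y : AddCircle (2*π)) := e
      rw [← sub_eq_zero, ← AddCircle.coe_sub, AddCircle.coe_eq_zero_iff] at e
      obtain ⟨m, hm⟩ := e
      have e2 : θ (y + m * (2*π)) = θ x := by
        rw [h.per_int]; rw [zsmul_eq_mul] at hm; linarith
      have e3 := hs.injective e2
      show (x : AddCircle (2*π)) = (y : AddCircle (2*π))
      rw [← sub_eq_zero, ← AddCircle.coe_sub, AddCircle.coe_eq_zero_iff]
      exact ⟨m, by rw [zsmul_eq_mul]; linarith⟩
    · intro y
      induction y using QuotientAddGroup.induction_on with | H y => ?_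
      obtain ⟨x, hx⟩ := hsurj y
      exact ⟨(x : AddCircle (2*π)), by rw [← hx]; rfl⟩
  exact ⟨Continuous.homeoOfEquivCompactToT2 (f := Equiv.ofBijective _ hbij) hcont, fun s => rfl⟩

lemma main [inst : Fact ((0 : ℝ) < 2 * π)]
    (f : AddCircle (2 * π) → ℝ) (hf : Continuous f) :
    ∃ (h : AddCircle (2 * π) ≃ₜ AddCircle (2 * π)) (v : AddCircle (2 * π) → ℝ),
      Continuous v ∧
      BoundedVariationOn (fun t : ℝ => v (t : AddCircle (2 * π))) (Set.Icc 0 (2 * π)) ∧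
      ∀ k : ℤ,
        fourierCoeff (fun t => (v t : ℂ)) k =
          -Complex.I * (k.sign : ℂ) * fourierCoeff (fun t => ((f (h t) : ℝ) : ℂ)) k := by
  have hpi := Real.two_pi_pos
  have hpi' := Real.pi_pos
  set F : ℝ → ℝ := fun s => 2*π * f (s : AddCircle (2*π)) with hFdef
  have hFp : Function.Periodic F (2*π) := by
    intro s; simp only [hFdef, AddCircle.coe_add_period]
  have hFc : Continuous F := continuous_const.mul (hf.comp (AddCircle.continuous_mk' (2*π)))
  have hFu : UniformContinuous F := by
    have h1 : UniformContinuous (fun x => 2*π * f x) :=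
      CompactSpace.uniformContinuous_of_continuous (by fun_prop)
    have h2 : UniformContinuous (fun s : ℝ => (s : AddCircle (2*π))) :=
      uniformContinuous_of_continuousAt_zero (QuotientAddGroup.mk' (AddSubgroup.zmultiples (2*π)))
        (AddCircle.continuous_mk' (2*π)).continuousAt
    exact h1.comp h2
  obtain ⟨B, hB⟩ : ∃ B, ∀ x, |F x| ≤ B := by
    obtain ⟨B, hB⟩ := (isCompact_range (show Continuous (fun x => 2*π * f x) by fun_prop)).isBounded.exists_norm_le
    exact ⟨B, fun x => hB _ ⟨(x : AddCircle (2*π)), rfl⟩⟩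
  obtain ⟨θ, c, hA, hst, hc, hV, hpos⟩ := exists_good hFu hFp hB
  obtain ⟨H, hH⟩ := exists_homeo hA hst hc
  set C := (1/(2*π)) * ∫ s in (0:ℝ)..(2*π), (θ s - s) with hC
  have hp : Function.Periodic (fun s => θ s - s - C) (2*π) := by
    intro s; simp only [hA.per]; ring
  refine ⟨H, hp.lift, ?_, bv_aux hA.mono C 0 (2*π), fun k => ?_⟩
  · refine continuous_coinduced_dom.2 ?_
    show Continuous (fun s => θ s - s - C)
    fun_prop
  rw [fc, fc (fun t => f (H t))]
  have e1 : ∀ s : ℝ, hp.lift (s : AddCircle (2*π)) = θ s - s - C := fun s => rfl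
  simp_rw [e1, hH]
  by_cases hk : k = 0
  · subst hk
    have e2 : ∀ s, ee 0 s = 1 := by intro s; simp [ee]
    simp_rw [e2, mul_one]
    rw [intervalIntegral.integral_ofReal, intervalIntegral.integral_sub, intervalIntegral.integral_const]
    · have hz : (∫ s in (0:ℝ)..(2*π), (θ s - s)) - (2*π - 0) • C = 0 := by
        rw [smul_eq_mul, hC]; field_simp; ring
      rw [hz]; simp
    · apply Continuous.intervalIntegrable; fun_prop
    · exact intervalIntegrable_const
  have hm := fourier_V hA hc hk C
  have hek := ee_cont k
  have e3 : ∫ s in (0:ℝ)..(2*π), (((V θ s).toReal : ℝ) : ℂ) * ee k s =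
      2 * π * ∫ s in (0:ℝ)..(2*π), (f (θ s : AddCircle (2*π)) : ℂ) * ee k s := by
    have e4 : ∫ s in (0:ℝ)..(2*π), (((V θ s).toReal : ℝ) : ℂ) * ee k s =
      ∫ s in (0:ℝ)..(2*π), ((2 * π : ℂ) * ((f (θ s : AddCircle (2*π)) : ℂ) * ee k s) + c * ee k s) := by
      apply intervalIntegral.integral_congr_ae
      filter_upwards [hV] with s hs _
      rw [hs, ENNReal.toReal_ofReal (hpos s).le]
      simp only [hFdef]
      push_cast; ring
    have hfc : Continuous (fun s => f (θ s : AddCircle (2*π))) :=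
      hf.comp ((AddCircle.continuous_mk' (2*π)).comp hc)
    rw [e4, intervalIntegral.integral_add, intervalIntegral.integral_const_mul,
      intervalIntegral.integral_const_mul, ee_int hk, mul_zero, add_zero]
    · apply Continuous.intervalIntegrable; fun_prop
    · apply Continuous.intervalIntegrable; fun_prop
  rw [e3] at hm
  have hpc : (2 * π : ℂ) ≠ 0 := by exact_mod_cast hpi.ne'
  have hs2 : ((k.sign : ℤ) : ℂ) * (k.sign : ℂ) = 1 := by
    have : k.sign * k.sign = 1 := by
      rcases lt_or_gt_of_ne hk with h | h
      · rw [Int.sign_eq_neg_one_of_neg h]; rfl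
      · rw [Int.sign_eq_one_of_pos h]; rfl
    exact_mod_cast this
  have hm2 : ∫ s in (0:ℝ)..(2*π), (f (θ s : AddCircle (2*π)) : ℂ) * ee k s =
      Complex.I * (k.sign : ℂ) * ∫ s in (0:ℝ)..(2*π), ((θ s - s - C : ℝ) : ℂ) * ee k s := by
    apply mul_left_cancel₀ hpc
    rw [hm]; ring
  rw [hm2, mul_smul_comm]
  congr 1
  generalize (∫ s in (0:ℝ)..(2*π), ((θ s - s - C : ℝ) : ℂ) * ee k s) = W
  linear_combination (-W) * hs2 * 1 + ((k.sign : ℂ) * (k.sign : ℂ) * W) * Complex.I_mul_I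

end JW
end
end JWproof

/-- **The Jurkat–Waterman theorem.** For every continuous real-valued function `f` on the
circle `𝕋 = ℝ/2πℤ` there is a homeomorphism `h` of `𝕋` onto itself such that the conjugate
function of `f ∘ h` (characterized by its Fourier coefficients) is continuous and of bounded
variation on `𝕋`. -/
theorem jurkat_waterman
    [inst : Fact ((0 : ℝ) < 2 * π)]
    (f : AddCircle (2 * π) → ℝ) (hf : Continuous f) :
    ∃ (h : AddCircle (2 * π) ≃ₜ AddCircle (2 * π)) (v : AddCircle (2 * π) → ℝ),
      Continuous v ∧
      BoundedVariationOn (fun t : ℝ => v (t : AddCircle (2 * π))) (Set.Icc 0 (2 * π)) ∧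
      ∀ k : ℤ,
        fourierCoeff (fun t => (v t : ℂ)) k =
          -Complex.I * (k.sign : ℂ) * fourierCoeff (fun t => ((f (h t) : ℝ) : ℂ)) k := by
  exact JW.main f hf
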